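/- Let G=(V,E) be a finite connected graph, let L be a laminar family of subsets of V, let c : E → ℝ≥0 be edge costs, and let x be a point of the spanning tree polytope of G. Then there exists a spanning tree T of G (identified with its edge set) such that Σ_{e∈T} c(e) ≤ (2+√7)·Σ_{e∈E} c(e)·x(e), and for every S ∈ L, |T ∩ δ(S)| ≤ (2+√7)²·x(δ(S)). -/

import Mathlib

open scoped Classical
open Finset

noncomputable section

variable {V : Type}

/-- The set of edges of `G` with exactly one endpoint in `S`. -/
def cutEdges [Fintype V] (G : SimpleGraph V) (S : Set V) : Finset (Sym2 V) :=
  Finset.univ.filter (fun e => e ∈ G.edgeSet ∧ ∃ u v, e = s(u, v) ∧ u ∈ S ∧ v ∉ S)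

/-- The set of edges of `G` with both endpoints in `S`. -/
def insideEdges [Fintype V] (G : SimpleGraph V) (S : Set V) : Finset (Sym2 V) :=
  Finset.univ.filter (fun e => e ∈ G.edgeSet ∧ ∀ v ∈ e, v ∈ S)

/-- A family of sets is laminar if any two members are disjoint or nested. -/
def Laminar (L : Set (Set V)) : Prop :=
  ∀ S T, S ∈ L → T ∈ L → S ∩ T = ∅ ∨ S ∩ T = S ∨ S ∩ T = T

/-- The spanning tree polytope of `G` : the convex hull of the indicator vectors of
the edge sets of spanning trees of `G`. -/
def stPolytope [Fintype V] (G : SimpleGraph V) : Set (Sym2 V → ℝ) :=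
  convexHull ℝ { y | ∃ T : SimpleGraph V, T ≤ G ∧ T.IsTree ∧
      y = fun e => if e ∈ T.edgeSet then (1 : ℝ) else 0 }

/-- `x` is `L`-aligned: for every `S ∈ L`, the restriction of `x` to `E(S)` lies in the
spanning tree polytope of the induced subgraph `G[S]`. -/
def IsAligned [Fintype V] (G : SimpleGraph V) (L : Set (Set V)) (x : Sym2 V → ℝ) : Prop :=
  ∀ S ∈ L, (fun e : Sym2 S => x (e.map Subtype.val)) ∈ stPolytope (G.induce S)

section

set_option linter.unusedSectionVars false

variable [Fintype V]

/-- The number of elements of `X` incident to `e`. -/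
def halfDegree (X : Finset V) (e : Sym2 V) : ℝ := ∑ v ∈ X, if v ∈ e then 1 else 0

/-- The pairs with one element inside `P` and one outside `P`. -/
def cutPairs (P : Finset V) : Finset (Sym2 V) :=
  univ.filter fun e => (∃ v ∈ e, v ∈ P) ∧ ∃ v ∈ e, v ∉ P

/-- Nonnegative points satisfying the rank inequalities of the graphic matroid of the
complete graph. -/
def ForestPoint (y : Sym2 V → ℝ) : Prop :=
  (∀ e, 0 ≤ y e) ∧ ∀ U : Finset V, U.Nonempty → ∑ e ∈ U.sym2, y e ≤ #U - 1

/-- A set whose rank inequality is attained with equality. -/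
def Tight (y : Sym2 V → ℝ) (U : Finset V) : Prop :=
  U.Nonempty ∧ ∑ e ∈ U.sym2, y e = #U - 1

lemma sym2_inter_eq (A B : Finset V) : (A ∩ B).sym2 = A.sym2 ∩ B.sym2 := by
  ext e; simp only [mem_sym2_iff, mem_inter]; aesop

lemma ForestPoint.uncross {y : Sym2 V → ℝ} (hy : ForestPoint y) {A B : Finset V}
    (hA : Tight y A) (hB : Tight y B) (hAB : (A ∩ B).Nonempty) :
    Tight y (A ∪ B) ∧ Tight y (A ∩ B) ∧
      ∀ e ∈ (A ∪ B).sym2, y e ≠ 0 → e ∈ A.sym2 ∨ e ∈ B.sym2 := by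
  have hsub : A.sym2 ∪ B.sym2 ⊆ (A ∪ B).sym2 :=
    union_subset (sym2_mono subset_union_left) (sym2_mono subset_union_right)
  have h1 : ∑ e ∈ A.sym2 ∪ B.sym2, y e + ∑ e ∈ (A ∩ B).sym2, y e = #A - 1 + (#B - 1) := by
    rw [sym2_inter_eq, sum_union_inter, hA.2, hB.2]
  have h2 : ∑ e ∈ (A ∪ B).sym2 \ (A.sym2 ∪ B.sym2), y e + ∑ e ∈ A.sym2 ∪ B.sym2, y e
      = ∑ e ∈ (A ∪ B).sym2, y e := sum_sdiff hsub
  have h0 : 0 ≤ ∑ e ∈ (A ∪ B).sym2 \ (A.sym2 ∪ B.sym2), y e := sum_nonneg fun e _ => hy.1 e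
  have hU := hy.2 (A ∪ B) (hAB.mono (inter_subset_left.trans subset_union_left))
  have hI := hy.2 (A ∩ B) hAB
  have hc : (#(A ∪ B) : ℝ) + #(A ∩ B) = #A + #B := by exact_mod_cast card_union_add_card_inter A B
  refine ⟨⟨hAB.mono (inter_subset_left.trans subset_union_left), by linarith⟩,
    ⟨hAB, by linarith⟩, fun e he hne => ?_⟩
  by_contra hcon
  have hz : ∑ e ∈ (A ∪ B).sym2 \ (A.sym2 ∪ B.sym2), y e = 0 := by linarith
  exact hne ((sum_eq_zero_iff_of_nonneg fun e _ => hy.1 e).1 hz e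
    (mem_sdiff.2 ⟨he, fun h => hcon (mem_union.1 h)⟩))

lemma ForestPoint.exists_min_tight {y : Sym2 V → ℝ} (hy : ForestPoint y) {W : Finset V}
    {e : Sym2 V} (hW : Tight y W) (he : e ∈ W.sym2) :
    ∃ U, Tight y U ∧ e ∈ U.sym2 ∧ ∀ W, Tight y W → e ∈ W.sym2 → U ⊆ W := by
  obtain ⟨U, hU, hmin⟩ := exists_min_image (univ.filter fun U => Tight y U ∧ e ∈ U.sym2) card
    ⟨W, by simp only [mem_filter, mem_univ, true_and]; exact ⟨hW, he⟩⟩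
  simp only [mem_filter, mem_univ, true_and] at hU hmin
  refine ⟨U, hU.1, hU.2, fun W hW he => ?_⟩
  have hI : e ∈ (U ∩ W).sym2 := by rw [sym2_inter_eq]; exact mem_inter.2 ⟨hU.2, he⟩
  have hne : (U ∩ W).Nonempty := by
    induction e with | _ u v => exact ⟨u, (mk_mem_sym2_iff.1 hI).1⟩
  have := eq_of_subset_of_card_le inter_subset_left
    (hmin _ ⟨(hy.uncross hU.1 hW hne).2.1, hI⟩)
  exact inter_eq_left.1 this

lemma ForestPoint.merge {y : Sym2 V → ℝ} (hy : ForestPoint y) (G : Finset (Finset V))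
    (hG : ∀ A ∈ G, Tight y A) :
    ∃ K : Finset (Finset V), (∀ A ∈ K, Tight y A) ∧
      (∀ A ∈ K, ∀ B ∈ K, A ≠ B → Disjoint A B) ∧
      (∀ A ∈ G, ∃ B ∈ K, A ⊆ B) ∧
      (∀ B ∈ K, ∀ v ∈ B, ∃ A ∈ G, v ∈ A ∧ A ⊆ B) ∧
      ∀ B ∈ K, ∀ e ∈ B.sym2, y e ≠ 0 → ∃ A ∈ G, e ∈ A.sym2 := by
  induction hn : #G using Nat.strong_induction_on generalizing G with
  | _ n ih =>
  by_cases hdis : ∀ A ∈ G, ∀ B ∈ G, A ≠ B → Disjoint A B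
  · exact ⟨G, hG, hdis, fun A hA => ⟨A, hA, Subset.rfl⟩,
      fun B hB v hv => ⟨B, hB, hv, Subset.rfl⟩, fun B hB e he _ => ⟨B, hB, he⟩⟩
  push Not at hdis
  obtain ⟨A, hA, B, hB, hne, hnd⟩ := hdis
  have hun := hy.uncross (hG A hA) (hG B hB) (not_disjoint_iff_nonempty_inter.1 hnd)
  have hB' : B ∈ G.erase A := mem_erase.2 ⟨hne.symm, hB⟩
  obtain ⟨K, h1, h2, h3, h4, h5⟩ := ih #(insert (A ∪ B) ((G.erase A).erase B)) (by
      have := card_insert_le (A ∪ B) ((G.erase A).erase B)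
      have h1 := card_erase_of_mem hB'
      have h2 := card_erase_of_mem hA
      have h3 := card_pos.2 ⟨_, hB'⟩
      omega) (insert (A ∪ B) ((G.erase A).erase B)) (by
      intro C hC
      rcases mem_insert.1 hC with rfl | hC
      · exact hun.1
      · exact hG C (mem_of_mem_erase (mem_of_mem_erase hC))) rfl
  have hback : ∀ C ∈ insert (A ∪ B) ((G.erase A).erase B), C = A ∪ B ∨ C ∈ G := fun C hC =>
    (mem_insert.1 hC).imp id fun h => mem_of_mem_erase (mem_of_mem_erase h)
  refine ⟨K, h1, h2, fun C hC => ?_, fun C hC v hv => ?_, fun C hC e he hye => ?_⟩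
  · obtain ⟨D, hD, hAD⟩ := h3 (A ∪ B) (mem_insert_self _ _)
    by_cases hCA : C = A
    · exact ⟨D, hD, hCA ▸ subset_union_left.trans hAD⟩
    by_cases hCB : C = B
    · exact ⟨D, hD, hCB ▸ subset_union_right.trans hAD⟩
    exact h3 C (mem_insert_of_mem (mem_erase.2 ⟨hCB, mem_erase.2 ⟨hCA, hC⟩⟩))
  · obtain ⟨D, hD, hvD, hDC⟩ := h4 C hC v hv
    rcases hback D hD with rfl | hD
    · rcases mem_union.1 hvD with h | h
      · exact ⟨A, hA, h, subset_union_left.trans hDC⟩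
      · exact ⟨B, hB, h, subset_union_right.trans hDC⟩
    · exact ⟨D, hD, hvD, hDC⟩
  · obtain ⟨D, hD, heD⟩ := h5 C hC e he hye
    rcases hback D hD with rfl | hD
    · rcases hun.2.2 e heD hye with h | h
      · exact ⟨A, hA, h⟩
      · exact ⟨B, hB, h⟩
    · exact ⟨D, hD, heD⟩

lemma mem_cutPairs_mk {P : Finset V} {u v : V} :
    s(u, v) ∈ cutPairs P ↔ (u ∈ P ∧ v ∉ P) ∨ (v ∈ P ∧ u ∉ P) := by
  simp only [cutPairs, mem_filter, mem_univ, true_and, Sym2.mem_iff, exists_eq_or_imp,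
    exists_eq_left]
  tauto

lemma sum_eq_sum_univ_ite {α : Type*} [Fintype α] (s : Finset α) (f : α → ℝ) :
    ∑ e ∈ s, f e = ∑ e, if e ∈ s then f e else 0 := by
  simp

lemma sum_sym2_eq_add_cut (f : Sym2 V → ℝ) {A S : Finset V} (h : A ⊆ S) :
    ∑ e ∈ S.sym2, f e = ∑ e ∈ A.sym2, f e + ∑ e ∈ (S \ A).sym2, f e +
      ∑ e ∈ cutPairs A ∩ S.sym2, f e := by
  rw [sum_eq_sum_univ_ite, sum_eq_sum_univ_ite A.sym2, sum_eq_sum_univ_ite (S \ A).sym2,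
    sum_eq_sum_univ_ite (cutPairs A ∩ S.sym2), ← sum_add_distrib, ← sum_add_distrib]
  refine sum_congr rfl fun e _ => ?_
  induction e with | _ u v =>
  have hu := @h u
  have hv := @h v
  simp only [mk_mem_sym2_iff, mem_sdiff, mem_inter, mem_cutPairs_mk]
  by_cases h1 : u ∈ A <;> by_cases h2 : v ∈ A <;> by_cases h3 : u ∈ S <;> by_cases h4 : v ∈ S <;>
    simp_all

lemma halfDegree_eq (X : Finset V) {e : Sym2 V} (he : ¬ e.IsDiag) :
    halfDegree X e = 2 * (if e ∈ X.sym2 then 1 else 0) + if e ∈ cutPairs X then 1 else 0 := by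
  induction e with | _ u v =>
  have huv : u ≠ v := by simpa using he
  have : ∀ w, (if w ∈ s(u, v) then (1 : ℝ) else 0) =
      (if w = u then 1 else 0) + if w = v then 1 else 0 := by
    intro w
    simp only [Sym2.mem_iff]
    by_cases h1 : w = u <;> by_cases h2 : w = v <;> simp_all
  simp only [halfDegree, this, sum_add_distrib, sum_ite_eq', mk_mem_sym2_iff, mem_cutPairs_mk]
  by_cases h1 : u ∈ X <;> by_cases h2 : v ∈ X <;> simp_all
  norm_num

lemma halfDegree_nonneg (X : Finset V) (e : Sym2 V) : 0 ≤ halfDegree X e :=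
  sum_nonneg fun v _ => by split_ifs <;> norm_num

lemma halfDegree_mono {X Y : Finset V} (h : X ⊆ Y) (e : Sym2 V) :
    halfDegree X e ≤ halfDegree Y e :=
  sum_le_sum_of_subset_of_nonneg h fun v _ _ => by split_ifs <;> norm_num

lemma halfDegree_biUnion {K : Finset (Finset V)}
    (hK : ∀ A ∈ K, ∀ B ∈ K, A ≠ B → Disjoint A B) (e : Sym2 V) :
    halfDegree (K.biUnion id) e = ∑ A ∈ K, halfDegree A e :=
  sum_biUnion fun A hA B hB hAB => hK A hA B hB hAB

lemma halfDegree_sdiff {A S : Finset V} (h : A ⊆ S) (e : Sym2 V) :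
    halfDegree (S \ A) e = halfDegree S e - halfDegree A e := by
  unfold halfDegree
  rw [eq_sub_iff_add_eq, sum_sdiff h]

lemma ForestPoint.eq_zero_of_isDiag {y : Sym2 V → ℝ} (hy : ForestPoint y) {e : Sym2 V}
    (he : e.IsDiag) : y e = 0 := by
  induction e with | _ u v =>
  obtain rfl : u = v := by simpa using he
  have := hy.2 {u} (singleton_nonempty u)
  simp only [sym2_singleton, sum_singleton, card_singleton] at this
  have h0 := hy.1 s(u, u)
  change y s(u, u) ≤ _ at this
  push_cast at this
  linarith

lemma ForestPoint.le_one {y : Sym2 V → ℝ} (hy : ForestPoint y) (e : Sym2 V) : y e ≤ 1 := by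
  induction e with | _ u v =>
  have h1 := hy.2 {u, v} (insert_nonempty _ _)
  have h2 : y s(u, v) ≤ ∑ e ∈ ({u, v} : Finset V).sym2, y e :=
    single_le_sum (fun e _ => hy.1 e) (by simp)
  have h3 : (#({u, v} : Finset V) : ℝ) ≤ 2 := by exact_mod_cast card_le_two
  linarith

lemma ForestPoint.tight_singleton {y : Sym2 V → ℝ} (hy : ForestPoint y) (v : V) :
    Tight y {v} := by
  refine ⟨singleton_nonempty v, ?_⟩
  have := hy.eq_zero_of_isDiag (e := s(v, v)) (by simp)
  simp only [sym2_singleton, sum_singleton, card_singleton, Nat.cast_one, sub_self]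
  exact this

lemma ForestPoint.tight_pair {y : Sym2 V → ℝ} (hy : ForestPoint y) {u v : V}
    (h : y s(u, v) = 1) : Tight y {u, v} := by
  have huv : u ≠ v := by
    rintro rfl
    rw [hy.eq_zero_of_isDiag (by simp)] at h
    norm_num at h
  refine ⟨insert_nonempty _ _, le_antisymm (hy.2 _ (insert_nonempty _ _)) ?_⟩
  rw [card_pair huv]
  push_cast
  calc (2 - 1 : ℝ) = y s(u, v) := by rw [h]; norm_num
    _ ≤ _ := single_le_sum (fun e _ => hy.1 e) (by simp)

/-- The elements of `S.sym2` that lie inside no member of `K`. -/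
def crossPairs (K : Finset (Finset V)) (S : Finset V) : Finset (Sym2 V) :=
  S.sym2.filter fun e => ∀ A ∈ K, e ∉ A.sym2

lemma sum_sym2_eq_add_crossPairs (f : Sym2 V → ℝ) {K : Finset (Finset V)} {S : Finset V}
    (hK : ∀ A ∈ K, ∀ B ∈ K, A ≠ B → Disjoint A B) (hS : ∀ A ∈ K, A ⊆ S) :
    ∑ e ∈ S.sym2, f e = ∑ A ∈ K, ∑ e ∈ A.sym2, f e + ∑ e ∈ crossPairs K S, f e := by
  have hun : K.biUnion (fun A => A.sym2) = S.sym2.filter fun e => ¬ ∀ A ∈ K, e ∉ A.sym2 := by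
    ext e
    simp only [mem_biUnion, mem_filter, not_forall, not_not, exists_prop]
    exact ⟨fun ⟨A, hA, he⟩ => ⟨sym2_mono (hS A hA) he, A, hA, he⟩, fun h => h.2⟩
  rw [← sum_biUnion, hun, crossPairs, add_comm, sum_filter_add_sum_filter_not]
  intro A hA B hB hAB
  refine disjoint_left.2 fun e heA heB => ?_
  induction e with | _ u v =>
  exact disjoint_left.1 (hK A hA B hB hAB) (mk_mem_sym2_iff.1 heA).1 (mk_mem_sym2_iff.1 heB).1

lemma sum_crossPairs_of_tight {y : Sym2 V → ℝ} {K : Finset (Finset V)} {S : Finset V}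
    (hK : ∀ A ∈ K, ∀ B ∈ K, A ≠ B → Disjoint A B) (hS : K.biUnion id = S)
    (hT : ∀ A ∈ K, Tight y A) :
    ∑ e ∈ S.sym2, y e = #S - #K + ∑ e ∈ crossPairs K S, y e := by
  have hc : (#S : ℝ) = ∑ A ∈ K, (#A : ℝ) := by
    rw [← hS]
    exact_mod_cast card_biUnion (t := id) fun A hA B hB hAB => hK A hA B hB hAB
  rw [sum_sym2_eq_add_crossPairs y hK (fun A hA => hS ▸ subset_biUnion_of_mem id hA),
    sum_congr rfl fun A hA => (hT A hA).2, hc]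
  simp

lemma sum_indicator_sym2_le_of_isTree {T : SimpleGraph V} (hT : T.IsTree) {U : Finset V}
    (hU : U.Nonempty) :
    ∑ e ∈ U.sym2, (if e ∈ T.edgeSet then (1 : ℝ) else 0) ≤ #U - 1 := by
  have : Nonempty U := hU.to_subtype
  let H : SimpleGraph U := T.comap Subtype.val
  have hH : H.IsAcyclic := hT.isAcyclic.comap ⟨Subtype.val, fun h => h⟩ Subtype.val_injective
  obtain ⟨F, hHF, -, hF⟩ := SimpleGraph.Connected.exists_isTree_le_of_le_of_isAcyclic
    SimpleGraph.connected_top le_top hH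
  have hcard : #F.edgeFinset + 1 = #U := by simpa using hF.card_edgeFinset
  have hsub : U.sym2.filter (fun e => e ∈ T.edgeSet) ⊆
      F.edgeFinset.image (Sym2.map Subtype.val) := by
    intro e he
    rw [mem_filter] at he
    induction e with | _ u v =>
    obtain ⟨hu, hv⟩ := mk_mem_sym2_iff.1 he.1
    exact mem_image.2 ⟨s(⟨u, hu⟩, ⟨v, hv⟩),
      SimpleGraph.mem_edgeFinset.2 (SimpleGraph.edgeSet_mono hHF he.2), rfl⟩
  have h1 := (card_le_card hsub).trans card_image_le
  rw [sum_boole]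
  have h2 : (#(U.sym2.filter fun e => e ∈ T.edgeSet) : ℝ) + 1 ≤ #U := by
    exact_mod_cast (by omega : _ + 1 ≤ _)
  linarith

lemma sum_indicator_of_isTree {T : SimpleGraph V} (hT : T.IsTree) :
    ∑ e, (if e ∈ T.edgeSet then (1 : ℝ) else 0) = Fintype.card V - 1 := by
  have h := hT.card_edgeFinset
  rw [sum_boole, ← h, SimpleGraph.edgeFinset]
  push_cast
  rw [add_sub_cancel_right]
  congr 2
  ext e
  simp

lemma forestPoint_of_mem_stPolytope {G : SimpleGraph V} {x : Sym2 V → ℝ}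
    (hx : x ∈ stPolytope G) :
    ForestPoint x ∧ ∑ e, x e = Fintype.card V - 1 ∧ ∀ e, x e ≠ 0 → e ∈ G.edgeSet := by
  have hconv : Convex ℝ {x : Sym2 V → ℝ | ForestPoint x ∧ ∑ e, x e = Fintype.card V - 1 ∧
      ∀ e, e ∉ G.edgeSet → x e = 0} := by
    rintro x ⟨⟨hx1, hx2⟩, hx3, hx4⟩ y ⟨⟨hy1, hy2⟩, hy3, hy4⟩ a b ha hb hab
    refine ⟨⟨fun e => ?_, fun U hU => ?_⟩, ?_, fun e he => ?_⟩
    · have := hx1 e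
      have := hy1 e
      simp only [Pi.add_apply, Pi.smul_apply, smul_eq_mul]
      positivity
    · simp only [Pi.add_apply, Pi.smul_apply, smul_eq_mul, sum_add_distrib, ← mul_sum]
      obtain rfl : b = 1 - a := by linarith
      nlinarith [mul_le_mul_of_nonneg_left (hx2 U hU) ha, mul_le_mul_of_nonneg_left (hy2 U hU) hb]
    · simp only [Pi.add_apply, Pi.smul_apply, smul_eq_mul, sum_add_distrib, ← mul_sum, hx3, hy3]
      rw [← add_mul, hab, one_mul]
    · simp [hx4 e he, hy4 e he]
  have := convexHull_min (s := { y | ∃ T : SimpleGraph V, T ≤ G ∧ T.IsTree ∧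
      y = fun e => if e ∈ T.edgeSet then (1 : ℝ) else 0 }) (by
    rintro y ⟨T, hTG, hT, rfl⟩
    refine ⟨⟨fun e => by positivity, fun U hU => sum_indicator_sym2_le_of_isTree hT hU⟩,
      sum_indicator_of_isTree hT, fun e he => if_neg fun h => he (SimpleGraph.edgeSet_mono hTG h)⟩)
    hconv hx
  exact ⟨this.1, this.2.1, fun e he => by_contra fun h => he (this.2.2 e h)⟩

/-- The rank inequalities force every nontrivial cut of a point of full rank to have mass at
least one. -/
lemma ForestPoint.one_le_sum_cut {y : Sym2 V → ℝ} (hy : ForestPoint y) {A S : Finset V}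
    (hS : Tight y S) (hAS : A ⊆ S) (hA : A.Nonempty) (hne : A ≠ S) :
    1 ≤ ∑ e ∈ cutPairs A ∩ S.sym2, y e := by
  have h := sum_sym2_eq_add_cut y hAS
  have h1 := hy.2 A hA
  have h2 := hy.2 (S \ A) (sdiff_nonempty.2 fun h => hne (hAS.antisymm h))
  have h3 : (#(S \ A) : ℝ) = #S - #A := by rw [card_sdiff_of_subset hAS, Nat.cast_sub (card_le_card hAS)]
  rw [hS.2] at h
  linarith

lemma ForestPoint.exists_isTree_of_integral {y : Sym2 V → ℝ} [Nonempty V] (hy : ForestPoint y)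
    (hV : Tight y univ) (hint : ∀ e, y e = 0 ∨ y e = 1) :
    ∃ T : SimpleGraph V, T.IsTree ∧ ∀ e, e ∈ T.edgeSet ↔ y e ≠ 0 := by
  let T := SimpleGraph.fromEdgeSet {e | y e ≠ 0}
  have hTe : ∀ e, e ∈ T.edgeSet ↔ y e ≠ 0 := by
    intro e
    simp only [T, SimpleGraph.edgeSet_fromEdgeSet, Set.mem_sdiff, Set.mem_ofPred_eq]
    exact ⟨fun h => h.1, fun h => ⟨h, fun hd => h (hy.eq_zero_of_isDiag hd)⟩⟩
  refine ⟨T, ?_, hTe⟩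
  rw [SimpleGraph.isTree_iff_connected_and_card]
  constructor
  · rw [SimpleGraph.connected_iff]
    refine ⟨fun u v => ?_, inferInstance⟩
    by_contra huv
    let A : Finset V := univ.filter fun w => T.Reachable u w
    have hA : A.Nonempty := ⟨u, by simp [A]⟩
    have hne : A ≠ univ := fun h => huv (mem_filter.1 (h.symm ▸ mem_univ v : v ∈ A)).2
    have h1 := hy.one_le_sum_cut hV (subset_univ A) hA hne
    have h2 : ∑ e ∈ cutPairs A ∩ univ.sym2, y e = 0 := by
      refine sum_eq_zero fun e he => ?_
      by_contra hne
      have heT := (hTe e).2 hne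
      induction e with | _ a b =>
      have hadj : T.Adj a b := heT
      have := mem_cutPairs_mk.1 (mem_inter.1 he).1
      simp only [A, mem_filter, mem_univ, true_and] at this
      rcases this with h | h
      · exact h.2 (h.1.trans hadj.reachable)
      · exact h.2 (h.1.trans hadj.symm.reachable)
    linarith
  · have h1 : ∑ e, y e = ∑ e, if e ∈ T.edgeSet then (1 : ℝ) else 0 := by
      refine sum_congr rfl fun e _ => ?_
      rcases hint e with h | h <;> simp [hTe, h]
    have h2 := hV.2
    rw [sym2_univ, h1, sum_boole, card_univ] at h2
    rw [Nat.card_eq_fintype_card, Nat.card_eq_fintype_card, Fintype.card_subtype]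
    have : (#(univ.filter fun e => e ∈ T.edgeSet) : ℝ) + 1 = Fintype.card V := by linarith
    exact_mod_cast this

/-- The maximal tight subsets of `S` partition `S`. -/
lemma ForestPoint.exists_tight_partition {y : Sym2 V → ℝ} (hy : ForestPoint y) (S : Finset V) :
    ∃ K : Finset (Finset V), (∀ A ∈ K, Tight y A) ∧
      (∀ A ∈ K, ∀ B ∈ K, A ≠ B → Disjoint A B) ∧ K.biUnion id = S ∧
      ∀ U, Tight y U → U ⊆ S → ∃ B ∈ K, U ⊆ B := by
  obtain ⟨K, h1, h2, h3, h4, -⟩ := hy.merge (S.powerset.filter (Tight y))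
    fun A hA => (mem_filter.1 hA).2
  have h5 : ∀ U, Tight y U → U ⊆ S → ∃ B ∈ K, U ⊆ B := fun U hU hUS =>
    h3 U (mem_filter.2 ⟨mem_powerset.2 hUS, hU⟩)
  refine ⟨K, h1, h2, ?_, h5⟩
  ext v
  simp only [mem_biUnion, id]
  constructor
  · rintro ⟨B, hB, hv⟩
    obtain ⟨A, hA, hvA, -⟩ := h4 B hB v hv
    exact mem_powerset.1 (mem_filter.1 hA).1 hvA
  · intro hv
    obtain ⟨B, hB, hvB⟩ := h5 {v} (hy.tight_singleton v) (singleton_subset_iff.2 hv)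
    exact ⟨B, hB, hvB (mem_singleton_self v)⟩

lemma eventually_add_mul_le {a b p q : ℝ} (hab : a ≤ b) (h : a = b → p ≤ q) :
    ∀ᶠ ε in nhdsWithin (0 : ℝ) (Set.Ioi 0), a + ε * p ≤ b + ε * q := by
  rcases hab.eq_or_lt with rfl | hlt
  · filter_upwards [self_mem_nhdsWithin] with ε (hε : 0 < ε)
    have := mul_le_mul_of_nonneg_left (h rfl) hε.le
    linarith
  · refine Filter.Eventually.filter_mono nhdsWithin_le_nhds ?_
    have h1 : Filter.Tendsto (fun ε : ℝ => a + ε * p) (nhds 0) (nhds a) := by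
      have : Continuous fun ε : ℝ => a + ε * p := by fun_prop
      simpa using this.tendsto 0
    have h2 : Filter.Tendsto (fun ε : ℝ => b + ε * q) (nhds 0) (nhds b) := by
      have : Continuous fun ε : ℝ => b + ε * q := by fun_prop
      simpa using this.tendsto 0
    filter_upwards [h1.eventually_lt h2 hlt] with ε hε using hε.le

lemma ForestPoint.eventually_add_smul {y d : Sym2 V → ℝ} (hy : ForestPoint y)
    (h0 : ∀ e, y e = 0 → 0 ≤ d e) (h1 : ∀ U, Tight y U → ∑ e ∈ U.sym2, d e ≤ 0) :
    ∀ᶠ ε in nhdsWithin (0 : ℝ) (Set.Ioi 0), ForestPoint (y + ε • d) := by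
  have ha : ∀ᶠ ε in nhdsWithin (0 : ℝ) (Set.Ioi 0), ∀ e, 0 + ε * 0 ≤ y e + ε * d e :=
    Filter.eventually_all.2 fun e => eventually_add_mul_le (hy.1 e) fun h => h0 e h.symm
  have hb : ∀ᶠ ε in nhdsWithin (0 : ℝ) (Set.Ioi 0), ∀ U : Finset V, U.Nonempty →
      ∑ e ∈ U.sym2, y e + ε * ∑ e ∈ U.sym2, d e ≤ (#U - 1) + ε * 0 := by
    refine Filter.eventually_all.2 fun U => ?_
    by_cases hU : U.Nonempty
    · filter_upwards [eventually_add_mul_le (hy.2 U hU) fun h => h1 U ⟨hU, h⟩] with ε hε _ using hε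
    · exact Filter.Eventually.of_forall fun ε h => absurd h hU
  filter_upwards [ha, hb] with ε h2 h3
  refine ⟨fun e => by simpa using h2 e, fun U hU => ?_⟩
  simpa [sum_add_distrib, ← mul_sum] using h3 U hU

lemma isClosed_forestPoint : IsClosed {y : Sym2 V → ℝ | ForestPoint y} := by
  have h : {y : Sym2 V → ℝ | ForestPoint y} = (⋂ e, {y | 0 ≤ y e}) ∩
      ⋂ U : Finset V, ⋂ _ : U.Nonempty, {y | ∑ e ∈ U.sym2, y e ≤ (#U : ℝ) - 1} := by
    ext y
    simp [ForestPoint]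
  rw [h]
  refine (isClosed_iInter fun e => isClosed_le (by fun_prop) (by fun_prop)).inter
    (isClosed_iInter fun U => isClosed_iInter fun _ => isClosed_le (by fun_prop) (by fun_prop))

/-- Under an upper bound dominating a point of the spanning tree polytope, there is a point of
full rank which, inside every member of a laminar family, meets the upper bound except on pairs
contained in tight subsets. -/
lemma exists_aligned [Nonempty V] {x : Sym2 V → ℝ} (hx : ForestPoint x) (hxV : Tight x univ)
    {η : ℝ} (hη : 1 ≤ η) {L : Finset (Finset V)}
    (hL : ∀ S ∈ L, ∀ T ∈ L, Disjoint S T ∨ S ⊆ T ∨ T ⊆ S) (hu : univ ∈ L) :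
    ∃ z, ForestPoint z ∧ (∀ e, z e ≤ η * x e) ∧ Tight z univ ∧
      ∀ S ∈ L, ∀ e ∈ S.sym2, z e ≠ η * x e → ∃ U, Tight z U ∧ e ∈ U.sym2 ∧ U ⊆ S := by
  let C : Set (Sym2 V → ℝ) := {z | ForestPoint z} ∩ Set.Icc 0 (fun e => η * x e)
  have hC : IsCompact C := isCompact_Icc.inter_left isClosed_forestPoint
  have hxC : x ∈ C := ⟨hx, hx.1, fun e => le_mul_of_one_le_left (hx.1 e) hη⟩
  obtain ⟨z, ⟨hz, -, hzx⟩, hmax⟩ := hC.exists_isMaxOn ⟨x, hxC⟩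
    (f := fun z => ∑ S ∈ L, ∑ e ∈ S.sym2, z e) (by fun_prop)
  have key : ∀ d : Sym2 V → ℝ, (∀ e, z e = 0 → 0 ≤ d e) → (∀ e, z e = η * x e → d e ≤ 0) →
      (∀ U, Tight z U → ∑ e ∈ U.sym2, d e ≤ 0) → ∑ S ∈ L, ∑ e ∈ S.sym2, d e ≤ 0 := by
    intro d h0 h1 h2
    have h3 : ∀ᶠ ε in nhdsWithin (0 : ℝ) (Set.Ioi 0), ∀ e, z e + ε * d e ≤ η * x e + ε * 0 :=
      Filter.eventually_all.2 fun e => eventually_add_mul_le (hzx e) (h1 e)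
    obtain ⟨ε, h4, h5, hε⟩ := ((hz.eventually_add_smul h0 h2).and
      (h3.and self_mem_nhdsWithin)).exists
    have h6 := hmax (show z + ε • d ∈ C from ⟨h4, h4.1, fun e => by simpa using h5 e⟩)
    simp only [Set.mem_ofPred_eq, Pi.add_apply, Pi.smul_apply, smul_eq_mul, sum_add_distrib,
      ← mul_sum] at h6
    have hε' : 0 < ε := hε
    by_contra hpos
    have := mul_pos hε' (not_le.1 hpos)
    linarith
  have sum_single : ∀ (U : Finset V) (f : Sym2 V),
      ∑ e ∈ U.sym2, (if e = f then (1 : ℝ) else 0) = if f ∈ U.sym2 then 1 else 0 := by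
    intro U f
    rw [sum_ite_eq']
  have hal : ∀ S ∈ L, ∀ e ∈ S.sym2, z e ≠ η * x e → ∃ U, Tight z U ∧ e ∈ U.sym2 ∧ U ⊆ S := by
    intro S hS e he hne
    have hex : ∃ W, Tight z W ∧ e ∈ W.sym2 := by
      by_contra hcon
      push Not at hcon
      have := key (fun g => if g = e then 1 else 0) (fun g _ => by split_ifs <;> norm_num)
        (fun g hg => by
          rw [if_neg]
          rintro rfl
          exact hne hg)
        (fun U hU => by rw [sum_single, if_neg (hcon U hU)])
      simp only [sum_single] at this
      have h1 : (1 : ℝ) ≤ ∑ S ∈ L, if e ∈ S.sym2 then 1 else 0 := by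
        have h2 : (if e ∈ (univ : Finset V).sym2 then (1 : ℝ) else 0) = 1 := if_pos (by simp)
        refine h2.ge.trans ?_
        exact single_le_sum (f := fun S : Finset V => if e ∈ S.sym2 then (1 : ℝ) else 0)
          (fun S _ => by positivity) hu
      linarith
    obtain ⟨W, hW, heW⟩ := hex
    obtain ⟨U, hU, heU, hmin⟩ := hz.exists_min_tight hW heW
    refine ⟨U, hU, heU, by_contra fun hUS => ?_⟩
    have hA : (U ∩ S).Nonempty := by
      induction e with | _ u v =>
      exact ⟨u, mem_inter.2 ⟨(mk_mem_sym2_iff.1 heU).1, (mk_mem_sym2_iff.1 he).1⟩⟩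
    have h1 := hz.one_le_sum_cut hU inter_subset_left hA fun h => hUS (inter_eq_left.1 h)
    obtain ⟨f, hf, hzf⟩ := exists_ne_zero_of_sum_ne_zero (by linarith :
      ∑ e ∈ cutPairs (U ∩ S) ∩ U.sym2, z e ≠ 0)
    obtain ⟨a, b, hfU, ha, hb, rfl⟩ : ∃ a b, f ∈ U.sym2 ∧ a ∈ S ∧ b ∉ S ∧ f = s(a, b) := by
      rw [mem_inter] at hf
      induction f with | _ a b =>
      have h2 := mk_mem_sym2_iff.1 hf.2
      have h3 := mem_cutPairs_mk.1 hf.1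
      simp only [mem_inter] at h3
      rcases h3 with h3 | h3
      · exact ⟨a, b, hf.2, h3.1.2, fun h => h3.2 ⟨h2.2, h⟩, rfl⟩
      · exact ⟨b, a, hf.2, h3.1.2, fun h => h3.2 ⟨h2.1, h⟩, Sym2.eq_swap⟩
    have hfS : s(a, b) ∉ S.sym2 := fun h => hb (mk_mem_sym2_iff.1 h).2
    have := key (fun g => (if g = e then 1 else 0) - if g = s(a, b) then 1 else 0)
      (fun g hg => by
        rw [if_neg (c := g = s(a, b)) (by rintro rfl; exact hzf hg)]
        split_ifs <;> norm_num)
      (fun g hg => by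
        rw [if_neg (c := g = e) (by rintro rfl; exact hne hg)]
        split_ifs <;> norm_num)
      (fun T hT => by
        rw [sum_sub_distrib, sum_single, sum_single]
        by_cases heT : e ∈ T.sym2
        · rw [if_pos heT, if_pos (sym2_mono (hmin T hT heT) hfU)]
          norm_num
        · rw [if_neg heT]
          split_ifs <;> norm_num)
    simp only [sum_sub_distrib, sum_single] at this
    rw [← sum_sub_distrib] at this
    have h2 : (1 : ℝ) ≤ ∑ T ∈ L, ((if e ∈ T.sym2 then 1 else 0) -
        if s(a, b) ∈ T.sym2 then 1 else 0) := by
      have h3 : ((if e ∈ S.sym2 then 1 else 0) - if s(a, b) ∈ S.sym2 then 1 else 0) = (1 : ℝ) := by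
        rw [if_pos he, if_neg hfS, sub_zero]
      refine h3.ge.trans ?_
      refine single_le_sum (f := fun T : Finset V => (if e ∈ T.sym2 then (1 : ℝ) else 0) -
        if s(a, b) ∈ T.sym2 then 1 else 0) (fun T hT => ?_) hS
      by_cases hfT : s(a, b) ∈ T.sym2
      · have hab := mk_mem_sym2_iff.1 hfT
        rcases hL S hS T hT with h | h | h
        · exact absurd hab.1 (disjoint_left.1 h ha)
        · simp [sym2_mono h he, hfT]
        · exact absurd (h hab.2) hb
      · rw [if_neg hfT]
        split_ifs <;> norm_num
    linarith
  refine ⟨z, hz, hzx, ⟨univ_nonempty, ?_⟩, hal⟩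
  obtain ⟨K, h1, h2, h3, h4⟩ := hz.exists_tight_partition univ
  have h5 := sum_crossPairs_of_tight h2 h3 h1
  have h6 := sum_sym2_eq_add_crossPairs x h2 (fun A _ => subset_univ A)
  have h7 : ∑ A ∈ K, ∑ e ∈ A.sym2, x e ≤ ∑ A ∈ K, ((#A : ℝ) - 1) :=
    sum_le_sum fun A hA => hx.2 A (h1 A hA).1
  have h8 : ∑ A ∈ K, ((#A : ℝ) - 1) = #(univ : Finset V) - #K := by
    have hc : (#(univ : Finset V) : ℝ) = ∑ A ∈ K, (#A : ℝ) := by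
      rw [← h3]
      exact_mod_cast card_biUnion (t := id) fun A hA B hB hAB => h2 A hA B hB hAB
    rw [hc]
    simp
  have h9 : ∑ e ∈ crossPairs K univ, z e = η * ∑ e ∈ crossPairs K univ, x e := by
    rw [mul_sum]
    refine sum_congr rfl fun e he => by_contra fun hne => ?_
    rw [crossPairs, mem_filter] at he
    obtain ⟨U, hU, heU, -⟩ := hal univ hu e he.1 hne
    obtain ⟨B, hB, hUB⟩ := h4 U hU (subset_univ U)
    exact he.2 B hB (sym2_mono hUB heU)
  have h10 : 0 < #K := by
    rw [card_pos]
    obtain ⟨v⟩ := ‹Nonempty V›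
    obtain ⟨B, hB, -⟩ := h4 {v} (hz.tight_singleton v) (subset_univ _)
    exact ⟨B, hB⟩
  have h11 : (1 : ℝ) ≤ #K := by exact_mod_cast h10
  have h12 := hxV.2
  have h13 := hz.2 univ univ_nonempty
  nlinarith

/-- The maximal members of `T` strictly contained in `S`. -/
def children (T : Finset (Finset V)) (S : Finset V) : Finset (Finset V) :=
  T.filter fun Q => Q ⊂ S ∧ ∀ Q' ∈ T, Q ⊂ Q' → ¬ Q' ⊂ S

lemma mem_children {T : Finset (Finset V)} {S Q : Finset V} :
    Q ∈ children T S ↔ Q ∈ T ∧ Q ⊂ S ∧ ∀ Q' ∈ T, Q ⊂ Q' → ¬ Q' ⊂ S := by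
  simp [children]

lemma children_disjoint {T : Finset (Finset V)}
    (hT : ∀ A ∈ T, ∀ B ∈ T, Disjoint A B ∨ A ⊆ B ∨ B ⊆ A) (S : Finset V) :
    ∀ A ∈ children T S, ∀ B ∈ children T S, A ≠ B → Disjoint A B := by
  intro A hA B hB hne
  rw [mem_children] at hA hB
  rcases hT A hA.1 B hB.1 with h | h | h
  · exact h
  · exact absurd hB.2.1 (hA.2.2 B hB.1 (h.ssubset_of_ne hne))
  · exact absurd hA.2.1 (hB.2.2 A hA.1 (h.ssubset_of_ne hne.symm))

lemma children_univ_nonempty {T : Finset (Finset V)} (hu : univ ∉ T) (hT : T.Nonempty) :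
    (children T univ).Nonempty := by
  obtain ⟨Q, hQ, hmax⟩ := exists_max_image T card hT
  refine ⟨Q, mem_children.2 ⟨hQ, (subset_univ Q).ssubset_of_ne fun h => hu (h ▸ hQ),
    fun Q' hQ' h _ => absurd (hmax Q' hQ') (not_le.2 (card_lt_card h))⟩⟩

lemma sum_children {T : Finset (Finset V)}
    (hT : ∀ A ∈ T, ∀ B ∈ T, Disjoint A B ∨ A ⊆ B ∨ B ⊆ A) (hne : ∀ A ∈ T, A.Nonempty)
    (hu : univ ∉ T) (g : Finset V → ℝ) :
    ∑ S ∈ insert univ T, ∑ Q ∈ children T S, g Q = ∑ Q ∈ T, g Q := by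
  rw [sum_comm' (t' := T) (s' := fun Q => (insert univ T).filter fun S => Q ∈ children T S)
    fun S Q => by
      rw [mem_filter]
      exact ⟨fun h => ⟨h, (mem_children.1 h.2).1⟩, fun h => h.1⟩]
  refine sum_congr rfl fun Q hQ => ?_
  have hQu : Q ⊂ univ := (subset_univ Q).ssubset_of_ne fun h => hu (h ▸ hQ)
  obtain ⟨S, hS, hmin⟩ := exists_min_image ((insert univ T).filter fun S => Q ⊂ S) card
    ⟨univ, mem_filter.2 ⟨mem_insert_self _ _, hQu⟩⟩
  rw [mem_filter] at hS
  have hSQ : Q ∈ children T S := mem_children.2 ⟨hQ, hS.2, fun Q' hQ' h1 h2 =>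
    absurd (hmin Q' (mem_filter.2 ⟨mem_insert_of_mem hQ', h1⟩)) (not_le.2 (card_lt_card h2))⟩
  have huniq : Finset.filter (fun S : Finset V => Q ∈ children T S) (insert univ T) =
      ({S} : Finset (Finset V)) := by
    refine eq_singleton_iff_unique_mem.2 ⟨mem_filter.2 ⟨hS.1, hSQ⟩, fun S' hS' => ?_⟩
    obtain ⟨hS', hS'Q⟩ := mem_filter.1 hS'
    by_contra hSS
    have h1 : Q ∈ T ∧ Q ⊂ S' ∧ ∀ Q' ∈ T, Q ⊂ Q' → ¬ Q' ⊂ S' := mem_children.1 hS'Q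
    have h2 : Q ∈ T ∧ Q ⊂ S ∧ ∀ Q' ∈ T, Q ⊂ Q' → ¬ Q' ⊂ S := mem_children.1 hSQ
    have hnd : ∀ A B : Finset V, Q ⊂ A → Q ⊂ B → ¬ Disjoint A B := fun A B hA hB hd => by
      obtain ⟨v, hv⟩ := hne Q hQ
      exact disjoint_left.1 hd (hA.1 hv) (hB.1 hv)
    have hlam : S ⊆ S' ∨ S' ⊆ S := by
      rcases mem_insert.1 hS.1 with h | h
      · exact Or.inr (h ▸ subset_univ S')
      rcases mem_insert.1 hS' with h' | h'
      · exact Or.inl (h' ▸ subset_univ S)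
      · exact (hT S h S' h').resolve_left (hnd _ _ h2.2.1 h1.2.1)
    have hmem : ∀ A B : Finset V, A ∈ insert univ T → A ⊂ B → A ∈ T := fun A B hA hAB => by
      refine (mem_insert.1 hA).resolve_left ?_
      rintro rfl
      exact hAB.2 (subset_univ B)
    rcases hlam with h | h
    · have h3 := h.ssubset_of_ne (Ne.symm hSS)
      exact h1.2.2 S (hmem S S' hS.1 h3) h2.2.1 h3
    · have h3 := h.ssubset_of_ne hSS
      exact h2.2.2 S' (hmem S' S hS' h3) h1.2.1 h3
  rw [huniq, sum_singleton]

lemma sum_sub_sum_children {T : Finset (Finset V)}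
    (hT : ∀ A ∈ T, ∀ B ∈ T, Disjoint A B ∨ A ⊆ B ∨ B ⊆ A) (hne : ∀ A ∈ T, A.Nonempty)
    (hu : univ ∉ T) (g : Finset V → ℝ) :
    ∑ S ∈ insert univ T, (g S - ∑ Q ∈ children T S, g Q) = g univ := by
  rw [sum_sub_distrib, sum_children hT hne hu, sum_insert hu]
  ring

/-- The pairs of value strictly between `0` and `1`. -/
def fracPairs (y : Sym2 V → ℝ) : Finset (Sym2 V) :=
  univ.filter fun e => y e ≠ 0 ∧ y e ≠ 1

lemma mem_fracPairs {y : Sym2 V → ℝ} {e : Sym2 V} : e ∈ fracPairs y ↔ y e ≠ 0 ∧ y e ≠ 1 := by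
  simp [fracPairs]

lemma ForestPoint.lt_one_of_mem_fracPairs {y : Sym2 V → ℝ} (hy : ForestPoint y) {e : Sym2 V}
    (he : e ∈ fracPairs y) : y e < 1 :=
  lt_of_le_of_ne (hy.le_one e) (mem_fracPairs.1 he).2

lemma ForestPoint.pos_of_mem_fracPairs {y : Sym2 V → ℝ} (hy : ForestPoint y) {e : Sym2 V}
    (he : e ∈ fracPairs y) : 0 < y e :=
  lt_of_le_of_ne (hy.1 e) (mem_fracPairs.1 he).1.symm

lemma ForestPoint.not_isDiag_of_mem_fracPairs {y : Sym2 V → ℝ} (hy : ForestPoint y) {e : Sym2 V}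
    (he : e ∈ fracPairs y) : ¬ e.IsDiag :=
  fun h => (mem_fracPairs.1 he).1 (hy.eq_zero_of_isDiag h)

lemma sum_inter_fracPairs_eq (y : Sym2 V → ℝ) (s : Finset (Sym2 V)) :
    ∑ e ∈ s, y e = ∑ e ∈ s ∩ fracPairs y, y e + #(s.filter fun e => y e = 1) := by
  have h1 : ∀ e, y e = (if e ∈ fracPairs y then y e else 0) + if y e = 1 then 1 else 0 := by
    intro e
    simp only [mem_fracPairs]
    by_cases h0 : y e = 0
    · simp [h0]
    · by_cases h1 : y e = 1 <;> simp [h0, h1]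
  rw [sum_congr rfl fun e _ => h1 e, sum_add_distrib, sum_boole, ← sum_filter,
    filter_mem_eq_inter]

lemma exists_int_sum_inter_fracPairs {y : Sym2 V → ℝ} {s : Finset (Sym2 V)}
    (h : ∃ n : ℤ, ∑ e ∈ s, y e = n) : ∃ n : ℤ, ∑ e ∈ s ∩ fracPairs y, y e = n := by
  obtain ⟨n, hn⟩ := h
  refine ⟨n - #(s.filter fun e => y e = 1), ?_⟩
  have := sum_inter_fracPairs_eq y s
  push_cast
  linarith

/-- `a` assigns to every pair the smallest tight set containing it. -/
def IsTightHull (y : Sym2 V → ℝ) (a : Sym2 V → Finset V) : Prop :=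
  ∀ e, Tight y (a e) ∧ e ∈ (a e).sym2 ∧ ∀ W, Tight y W → e ∈ W.sym2 → a e ⊆ W

lemma ForestPoint.exists_isTightHull {y : Sym2 V → ℝ} (hy : ForestPoint y) (hV : Tight y univ) :
    ∃ a, IsTightHull y a := by
  choose a ha using fun e : Sym2 V => hy.exists_min_tight hV (e := e) (by simp)
  exact ⟨a, ha⟩

lemma IsTightHull.mem_sym2_iff {y : Sym2 V → ℝ} {a : Sym2 V → Finset V} (ha : IsTightHull y a)
    {W : Finset V} (hW : Tight y W) {e : Sym2 V} : e ∈ W.sym2 ↔ a e ⊆ W :=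
  ⟨(ha e).2.2 W hW, fun h => sym2_mono h (ha e).2.1⟩

lemma IsTightHull.exists_int_sum {y : Sym2 V → ℝ} {a : Sym2 V → Finset V} (hy : ForestPoint y)
    (ha : IsTightHull y a) {e : Sym2 V} (he : e ∈ fracPairs y) :
    ∃ n : ℤ, ∑ f ∈ (fracPairs y).filter (fun f => a f = a e), y f = n := by
  have hed := hy.not_isDiag_of_mem_fracPairs he
  obtain ⟨K, h1, h2, h3, h4, h5⟩ := hy.merge
    ((a e).powerset.filter fun A => Tight y A ∧ e ∉ A.sym2) fun A hA => (mem_filter.1 hA).2.1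
  simp only [mem_filter, mem_powerset] at h3 h4 h5
  have hK : K.biUnion id = a e := by
    ext v
    simp only [mem_biUnion, id]
    constructor
    · rintro ⟨B, hB, hv⟩
      obtain ⟨A, hA, hvA, -⟩ := h4 B hB v hv
      exact hA.1 hvA
    · intro hv
      obtain ⟨B, hB, hvB⟩ := h3 {v} ⟨singleton_subset_iff.2 hv, hy.tight_singleton v, fun h => by
        rw [sym2_singleton, mem_singleton] at h
        exact hed (h ▸ Sym2.diag_isDiag v)⟩
      exact ⟨B, hB, hvB (mem_singleton_self v)⟩
  have hcross : ∀ f, y f ≠ 0 → (f ∈ crossPairs K (a e) ↔ a f = a e) := by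
    intro f hf
    rw [crossPairs, mem_filter]
    constructor
    · rintro ⟨hfe, hfK⟩
      have hsub := (ha f).2.2 _ (ha e).1 hfe
      by_contra hne
      obtain ⟨B, hB, hfB⟩ := h3 (a f) ⟨hsub, (ha f).1, fun hef =>
        hne (hsub.antisymm ((ha e).2.2 _ (ha f).1 hef))⟩
      exact hfK B hB (sym2_mono hfB (ha f).2.1)
    · intro hfe
      refine ⟨hfe ▸ (ha f).2.1, fun B hB hfB => ?_⟩
      obtain ⟨A, hA, hfA⟩ := h5 B hB f hfB hf
      exact hA.2.2 (sym2_mono (hfe ▸ (ha f).2.2 A hA.2.1 hfA) (ha e).2.1)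
  have hset : (fracPairs y).filter (fun f => a f = a e) = crossPairs K (a e) ∩ fracPairs y := by
    ext f
    rw [mem_filter, mem_inter]
    exact ⟨fun h => ⟨(hcross f (mem_fracPairs.1 h.1).1).2 h.2, h.1⟩,
      fun h => ⟨h.2, (hcross f (mem_fracPairs.1 h.2).1).1 h.1⟩⟩
  rw [hset]
  refine exists_int_sum_inter_fracPairs ⟨#K - 1, ?_⟩
  have h6 := sum_crossPairs_of_tight h2 hK h1
  rw [(ha e).1.2] at h6
  push_cast
  linarith

/-- The fractional pairs having the same smallest tight set as `e`. -/
def atom (y : Sym2 V → ℝ) (a : Sym2 V → Finset V) (A : Finset V) : Finset (Sym2 V) :=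
  (fracPairs y).filter fun f => a f = A

lemma mem_atom {y : Sym2 V → ℝ} {a : Sym2 V → Finset V} {A : Finset V} {f : Sym2 V} :
    f ∈ atom y a A ↔ f ∈ fracPairs y ∧ a f = A := by
  simp [atom]

/-- A direction supported on the fractional pairs that preserves all sums over atoms and over the
cuts of members of `T` vanishes. -/
def Rigid (y : Sym2 V → ℝ) (a : Sym2 V → Finset V) (T : Finset (Finset V)) : Prop :=
  ∀ d : Sym2 V → ℝ, (∀ e ∉ fracPairs y, d e = 0) → (∀ A, ∑ f ∈ atom y a A, d f = 0) →
    (∀ S ∈ T, ∑ f ∈ cutPairs S, d f = 0) → d = 0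

lemma Rigid.card_le {y : Sym2 V → ℝ} {a : Sym2 V → Finset V} {T : Finset (Finset V)}
    (h : Rigid y a T) : #(fracPairs y) ≤ #((fracPairs y).image a) + #T := by
  let ℓ : (Sym2 V → ℝ) →ₗ[ℝ]
      (({e // e ∉ fracPairs y} ⊕ ((fracPairs y).image a ⊕ T)) → ℝ) :=
    LinearMap.pi (Sum.elim (fun e => LinearMap.proj e.1)
      (Sum.elim (fun A => ∑ f ∈ atom y a A.1, LinearMap.proj f)
        (fun S => ∑ f ∈ cutPairs S.1, LinearMap.proj f)))
  have hℓ : Function.Injective ℓ := by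
    rw [injective_iff_map_eq_zero]
    intro d hd
    refine h d (fun e he => ?_) (fun A => ?_) (fun S hS => ?_)
    · simpa [ℓ] using congr_fun hd (Sum.inl ⟨e, he⟩)
    · by_cases hA : A ∈ (fracPairs y).image a
      · simpa [ℓ] using congr_fun hd (Sum.inr (Sum.inl ⟨A, hA⟩))
      · refine sum_eq_zero fun f hf => absurd (mem_image.2 ⟨f, ?_⟩) hA
        exact mem_atom.1 hf
    · simpa [ℓ] using congr_fun hd (Sum.inr (Sum.inr ⟨S, hS⟩))
  have h1 := LinearMap.finrank_le_finrank_of_injective hℓ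
  rw [Module.finrank_fintype_fun_eq_card, Module.finrank_fintype_fun_eq_card, Fintype.card_sum,
    Fintype.card_sum, Fintype.card_subtype_compl, Fintype.card_coe, Fintype.card_coe,
    Fintype.card_coe] at h1
  have h2 := card_le_univ (fracPairs y)
  omega

lemma Rigid.exists_minimal {y : Sym2 V → ℝ} {a : Sym2 V → Finset V} {R : Finset (Finset V)}
    (h : Rigid y a R) : ∃ T ⊆ R, Rigid y a T ∧ ∀ S ∈ T, ∃ d : Sym2 V → ℝ,
      (∀ e ∉ fracPairs y, d e = 0) ∧ (∀ A, ∑ f ∈ atom y a A, d f = 0) ∧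
      (∀ Q ∈ T, Q ≠ S → ∑ f ∈ cutPairs Q, d f = 0) ∧ ∑ f ∈ cutPairs S, d f ≠ 0 := by
  obtain ⟨T, hT, hmin⟩ := exists_min_image (R.powerset.filter (Rigid y a)) card
    ⟨R, mem_filter.2 ⟨mem_powerset.2 Subset.rfl, h⟩⟩
  rw [mem_filter, mem_powerset] at hT
  refine ⟨T, hT.1, hT.2, fun S hS => ?_⟩
  by_contra hcon
  push Not at hcon
  refine absurd (hmin (T.erase S) (mem_filter.2 ⟨mem_powerset.2 ((erase_subset _ _).trans hT.1),
    fun d h1 h2 h3 => hT.2 d h1 h2 fun Q hQ => ?_⟩)) (not_le.2 (card_erase_lt_of_mem hS))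
  by_cases hQS : Q = S
  · rw [hQS]
    exact hcon d h1 h2 fun Q' hQ' hne => h3 Q' (mem_erase.2 ⟨hne, hQ'⟩)
  · exact h3 Q (mem_erase.2 ⟨hQS, hQ⟩)

lemma sum_eq_sum_atoms {y : Sym2 V → ℝ} {a : Sym2 V → Finset V} {s : Finset (Sym2 V)}
    (hs : s ⊆ fracPairs y) (hsat : ∀ e ∈ s, ∀ f ∈ fracPairs y, a f = a e → f ∈ s)
    (g : Sym2 V → ℝ) : ∑ e ∈ s, g e = ∑ A ∈ s.image a, ∑ f ∈ atom y a A, g f := by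
  rw [← sum_fiberwise_of_maps_to (t := s.image a) fun e he => mem_image_of_mem a he]
  refine sum_congr rfl fun A hA => sum_congr ?_ fun _ _ => rfl
  obtain ⟨e, he, rfl⟩ := mem_image.1 hA
  ext f
  rw [mem_filter, mem_atom]
  exact ⟨fun h => ⟨hs h.1, h.2⟩, fun h => ⟨hsat e he f h.1 h.2, h.2⟩⟩

lemma IsTightHull.saturated {y : Sym2 V → ℝ} {a : Sym2 V → Finset V} (ha : IsTightHull y a)
    {K : Finset (Finset V)} {S : Finset V} (hS : Tight y S) (hK : ∀ A ∈ K, Tight y A) :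
    ∀ e ∈ crossPairs K S ∩ fracPairs y, ∀ f ∈ fracPairs y, a f = a e →
      f ∈ crossPairs K S ∩ fracPairs y := by
  intro e he f hf hfe
  simp only [mem_inter, crossPairs, mem_filter] at he ⊢
  refine ⟨⟨?_, fun A hA => ?_⟩, hf⟩
  · rw [ha.mem_sym2_iff hS, hfe, ← ha.mem_sym2_iff hS]
    exact he.1.1
  · rw [ha.mem_sym2_iff (hK A hA), hfe, ← ha.mem_sym2_iff (hK A hA)]
    exact he.1.2 A hA

lemma crossPairs_empty (S : Finset V) : crossPairs ∅ S = S.sym2 := by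
  simp [crossPairs]

lemma IsTightHull.sum_sym2_eq_zero {y : Sym2 V → ℝ} {a : Sym2 V → Finset V}
    (ha : IsTightHull y a) {d : Sym2 V → ℝ} (h1 : ∀ e ∉ fracPairs y, d e = 0)
    (h2 : ∀ A, ∑ f ∈ atom y a A, d f = 0) {S : Finset V} (hS : Tight y S) :
    ∑ e ∈ S.sym2, d e = 0 := by
  have h3 := sum_eq_sum_atoms (s := crossPairs ∅ S ∩ fracPairs y) inter_subset_right
    (ha.saturated hS (by simp)) d
  rw [sum_eq_zero fun A _ => h2 A, crossPairs_empty] at h3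
  rw [← h3]
  exact (sum_subset inter_subset_left fun e he hne => h1 e fun h => hne (mem_inter.2 ⟨he, h⟩)).symm

/-- The inverse of the size of the atom containing `e`. -/
def atomWeight (y : Sym2 V → ℝ) (a : Sym2 V → Finset V) (e : Sym2 V) : ℝ :=
  (#(atom y a (a e)) : ℝ)⁻¹

lemma sum_atom_atomWeight {y : Sym2 V → ℝ} {a : Sym2 V → Finset V} {e : Sym2 V}
    (he : e ∈ fracPairs y) : ∑ f ∈ atom y a (a e), atomWeight y a f = 1 := by
  have h0 : (#(atom y a (a e)) : ℝ) ≠ 0 := by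
    exact_mod_cast (card_pos.2 ⟨e, mem_atom.2 ⟨he, rfl⟩⟩).ne'
  rw [sum_congr rfl fun f hf => show atomWeight y a f = (#(atom y a (a e)) : ℝ)⁻¹ by
    rw [atomWeight, (mem_atom.1 hf).2], sum_const, nsmul_eq_mul, mul_inv_cancel₀ h0]

lemma sum_atomWeight (y : Sym2 V → ℝ) (a : Sym2 V → Finset V) :
    ∑ e ∈ fracPairs y, atomWeight y a e = #((fracPairs y).image a) := by
  rw [sum_eq_sum_atoms (a := a) Subset.rfl fun _ _ f hf _ => hf, card_eq_sum_ones]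
  push_cast
  refine sum_congr rfl fun A hA => ?_
  obtain ⟨e, he, rfl⟩ := mem_image.1 hA
  exact sum_atom_atomWeight he

lemma IsTightHull.sum_nonneg {y : Sym2 V → ℝ} {a : Sym2 V → Finset V} (hy : ForestPoint y)
    (ha : IsTightHull y a) {K : Finset (Finset V)} {S : Finset V} (hS : Tight y S)
    (hK : ∀ A ∈ K, Tight y A) :
    0 ≤ ∑ e ∈ crossPairs K S ∩ fracPairs y, (y e - atomWeight y a e) ∧
      0 ≤ ∑ e ∈ crossPairs K S ∩ fracPairs y, (1 - y e - atomWeight y a e) := by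
  have hat : ∀ e ∈ fracPairs y, 1 ≤ ∑ f ∈ atom y a (a e), y f ∧
      ∑ f ∈ atom y a (a e), y f + 1 ≤ #(atom y a (a e)) := by
    intro e he
    have hne : (atom y a (a e)).Nonempty := ⟨e, mem_atom.2 ⟨he, rfl⟩⟩
    obtain ⟨n, hn⟩ := ha.exists_int_sum hy he
    change ∑ f ∈ atom y a (a e), y f = n at hn
    have h1 : 0 < ∑ f ∈ atom y a (a e), y f :=
      sum_pos (fun f hf => hy.pos_of_mem_fracPairs (mem_atom.1 hf).1) hne
    have h2 : ∑ f ∈ atom y a (a e), y f < ∑ f ∈ atom y a (a e), 1 :=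
      sum_lt_sum_of_nonempty hne fun f hf => hy.lt_one_of_mem_fracPairs (mem_atom.1 hf).1
    rw [sum_const, nsmul_eq_mul, mul_one] at h2
    rw [hn] at h1 h2 ⊢
    have h3 : 0 < n := by exact_mod_cast h1
    have h4 : n < #(atom y a (a e)) := by exact_mod_cast h2
    exact ⟨by exact_mod_cast h3, by exact_mod_cast h4⟩
  have hsat := ha.saturated hS hK
  rw [sum_eq_sum_atoms inter_subset_right hsat, sum_eq_sum_atoms inter_subset_right hsat]
  constructor <;> refine Finset.sum_nonneg fun A hA => ?_ <;>
    obtain ⟨e, he, rfl⟩ := mem_image.1 hA <;> have he' := (mem_inter.1 he).2 <;>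
    have h1 := hat e he' <;> simp only [sum_sub_distrib, sum_atom_atomWeight he', sum_const,
      nsmul_eq_mul, mul_one] <;> linarith

/-- The share of the count `#(fracPairs y) - #atoms` charged to a set `S` with children `K`. -/
def nodeValue (y : Sym2 V → ℝ) (a : Sym2 V → Finset V) (K : Finset (Finset V)) (S : Finset V) :
    ℝ :=
  ∑ e ∈ fracPairs y, halfDegree (S \ K.biUnion id) e * (y e / 2 + 1 / 4) +
    ∑ e ∈ crossPairs K S ∩ fracPairs y, (1 / 2 - y e - atomWeight y a e)

lemma ForestPoint.sum_halfDegree {y : Sym2 V → ℝ} (hy : ForestPoint y) (X : Finset V)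
    (g : Sym2 V → ℝ) : ∑ e ∈ fracPairs y, halfDegree X e * g e =
      2 * ∑ e ∈ X.sym2 ∩ fracPairs y, g e + ∑ e ∈ cutPairs X ∩ fracPairs y, g e := by
  rw [inter_comm, ← filter_mem_eq_inter, inter_comm, ← filter_mem_eq_inter, sum_filter,
    sum_filter, mul_sum, ← sum_add_distrib]
  refine sum_congr rfl fun e he => ?_
  rw [halfDegree_eq X (hy.not_isDiag_of_mem_fracPairs he)]
  split_ifs <;> ring

lemma sum_nodeValue {y : Sym2 V → ℝ} (hy : ForestPoint y) (a : Sym2 V → Finset V)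
    {T : Finset (Finset V)} (hT : ∀ A ∈ T, ∀ B ∈ T, Disjoint A B ∨ A ⊆ B ∨ B ⊆ A)
    (hne : ∀ A ∈ T, A.Nonempty) (hu : univ ∉ T) :
    ∑ S ∈ insert univ T, nodeValue y a (children T S) S =
      #(fracPairs y) - #((fracPairs y).image a) := by
  let F : Finset V → ℝ := fun S => ∑ e ∈ fracPairs y, halfDegree S e * (y e / 2 + 1 / 4) +
    ∑ e ∈ S.sym2, if e ∈ fracPairs y then 1 / 2 - y e - atomWeight y a e else 0
  have h1 : ∀ S ∈ insert univ T, nodeValue y a (children T S) S =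
      F S - ∑ Q ∈ children T S, F Q := by
    intro S _
    have hsub : ∀ A ∈ children T S, A ⊆ S := fun A hA => (mem_children.1 hA).2.1.subset
    have hdis := children_disjoint hT S
    have h2 := sum_sym2_eq_add_crossPairs
      (fun e => if e ∈ fracPairs y then 1 / 2 - y e - atomWeight y a e else 0) hdis hsub
    have h3 : ∑ e ∈ fracPairs y, halfDegree (S \ (children T S).biUnion id) e *
        (y e / 2 + 1 / 4) = ∑ e ∈ fracPairs y, halfDegree S e * (y e / 2 + 1 / 4) -
        ∑ Q ∈ children T S, ∑ e ∈ fracPairs y, halfDegree Q e * (y e / 2 + 1 / 4) := by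
      rw [sum_comm, ← sum_sub_distrib]
      refine sum_congr rfl fun e _ => ?_
      rw [halfDegree_sdiff (biUnion_subset (t := id) |>.2 hsub), halfDegree_biUnion hdis, sub_mul,
        sum_mul]
    simp only [← sum_filter, filter_mem_eq_inter] at h2
    simp only [nodeValue, F, h3, sum_add_distrib, ← sum_filter, filter_mem_eq_inter, h2]
    ring
  rw [sum_congr rfl h1, sum_sub_sum_children hT hne hu]
  simp only [F, hy.sum_halfDegree, ← sum_filter, filter_mem_eq_inter, sym2_univ, univ_inter]
  have h4 : cutPairs (univ : Finset V) = ∅ := by simp [cutPairs]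
  rw [h4, empty_inter, sum_empty, ← sum_atomWeight, sum_sub_distrib, sum_sub_distrib,
    sum_add_distrib, sum_const, sum_const, ← sum_div]
  simp only [nsmul_eq_mul]
  ring

lemma three_le_nodeValue {y : Sym2 V → ℝ} {a : Sym2 V → Finset V} (hy : ForestPoint y)
    (ha : IsTightHull y a) {S : Finset V} (hS : Tight y S)
    (hint : ∃ n : ℤ, ∑ e ∈ cutPairs S, y e = n)
    (hcnt : ∑ e ∈ cutPairs S, y e + 9 ≤ #((cutPairs S).filter fun e => y e ≠ 0)) :
    3 ≤ nodeValue y a ∅ S := by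
  obtain ⟨h1, h2⟩ := ha.sum_nonneg hy hS (K := ∅) (by simp)
  have h3 : ∑ e ∈ cutPairs S ∩ fracPairs y, y e + 9 ≤ #(cutPairs S ∩ fracPairs y) := by
    have h4 := sum_inter_fracPairs_eq y (cutPairs S)
    have h5 : (cutPairs S).filter (fun e => y e ≠ 0) =
        cutPairs S ∩ fracPairs y ∪ (cutPairs S).filter (fun e => y e = 1) := by
      ext e
      simp only [mem_filter, mem_union, mem_inter, mem_fracPairs]
      by_cases h0 : y e = 1 <;> simp [h0]
    have h6 : (#((cutPairs S).filter fun e => y e ≠ 0) : ℝ) ≤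
        #(cutPairs S ∩ fracPairs y) + #((cutPairs S).filter fun e => y e = 1) := by
      rw [h5]
      exact_mod_cast card_union_le _ _
    linarith
  obtain ⟨n, hn⟩ := exists_int_sum_inter_fracPairs hint
  have h7 : 0 ≤ ∑ e ∈ cutPairs S ∩ fracPairs y, y e := Finset.sum_nonneg fun e _ => hy.1 e
  have h8 : 1 ≤ ∑ e ∈ cutPairs S ∩ fracPairs y, y e := by
    have hne : (cutPairs S ∩ fracPairs y).Nonempty := by
      rw [← card_pos]
      have : (0 : ℝ) < #(cutPairs S ∩ fracPairs y) := by linarith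
      exact_mod_cast this
    have h9 : 0 < ∑ e ∈ cutPairs S ∩ fracPairs y, y e :=
      sum_pos (fun e he => hy.pos_of_mem_fracPairs (mem_inter.1 he).2) hne
    rw [hn] at h9 ⊢
    have h10 : 0 < n := by exact_mod_cast h9
    exact_mod_cast h10
  have h11 : 0 ≤ ∑ e ∈ S.sym2 ∩ fracPairs y, y e := Finset.sum_nonneg fun e _ => hy.1 e
  rw [nodeValue, biUnion_empty, sdiff_empty, hy.sum_halfDegree]
  rw [crossPairs_empty] at h1 h2 ⊢
  simp only [sum_sub_distrib, sum_add_distrib, sum_const, nsmul_eq_mul, ← sum_div] at h1 h2 ⊢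
  linarith

lemma one_le_nodeValue {y : Sym2 V → ℝ} {a : Sym2 V → Finset V} (hy : ForestPoint y)
    (ha : IsTightHull y a) {S Q : Finset V} (hS : Tight y S) (hQ : Tight y Q) (hQS : Q ⊆ S)
    (hintS : ∃ n : ℤ, ∑ e ∈ cutPairs S, y e = n) (hintQ : ∃ n : ℤ, ∑ e ∈ cutPairs Q, y e = n)
    (hne : ∃ e ∈ fracPairs y, halfDegree (S \ Q) e ≠ if e ∈ crossPairs {Q} S then 1 else 0) :
    1 ≤ nodeValue y a {Q} S := by
  have hTQ : ∀ A ∈ ({Q} : Finset (Finset V)), Tight y A := by simpa using hQ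
  obtain ⟨h1, h2⟩ := ha.sum_nonneg hy hS hTQ
  let G : Sym2 V → ℝ := fun e => halfDegree (S \ Q) e - if e ∈ crossPairs {Q} S then 1 else 0
  have hGint : ∀ e, ∃ n : ℤ, G e = n := by
    intro e
    refine ⟨∑ v ∈ S \ Q, (if v ∈ e then 1 else 0) - if e ∈ crossPairs {Q} S then 1 else 0, ?_⟩
    simp only [G, halfDegree]
    push_cast
    rfl
  have hG0 : ∀ e, 0 ≤ G e := by
    intro e
    simp only [G]
    split_ifs with he
    · rw [sub_nonneg]
      simp only [crossPairs, mem_filter, mem_singleton, forall_eq] at he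
      obtain ⟨v, hve, hv⟩ : ∃ v ∈ e, v ∈ S \ Q := by
        by_contra hcon
        push Not at hcon
        refine he.2 (mem_sym2_iff.2 fun v hv => by_contra fun hvQ => hcon v hv ?_)
        exact mem_sdiff.2 ⟨mem_sym2_iff.1 he.1 v hv, hvQ⟩
      calc (1 : ℝ) = if v ∈ e then 1 else 0 := by rw [if_pos hve]
        _ ≤ halfDegree (S \ Q) e := single_le_sum
          (f := fun v : V => if v ∈ e then (1 : ℝ) else 0) (fun v _ => by positivity) hv
    · rw [sub_zero]
      exact halfDegree_nonneg _ _
  have hsplit : ∀ g : Sym2 V → ℝ, ∑ e ∈ fracPairs y, halfDegree (S \ Q) e * g e =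
      ∑ e ∈ fracPairs y, G e * g e + ∑ e ∈ crossPairs {Q} S ∩ fracPairs y, g e := by
    intro g
    rw [inter_comm, ← filter_mem_eq_inter, sum_filter, ← sum_add_distrib]
    refine sum_congr rfl fun e _ => ?_
    simp only [G]
    split_ifs <;> ring
  obtain ⟨e₀, he₀, hne₀⟩ := hne
  have hGe₀ : 0 < G e₀ := lt_of_le_of_ne (hG0 e₀) (sub_ne_zero.2 hne₀).symm
  have hmass : ∃ n : ℤ, ∑ e ∈ fracPairs y, G e * y e = n := by
    have hsym : ∀ {U : Finset V}, Tight y U → ∃ n : ℤ, ∑ e ∈ U.sym2, y e = n := fun {U} hU =>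
      ⟨#U - 1, by rw [hU.2]; push_cast; rfl⟩
    obtain ⟨n1, hn1⟩ := exists_int_sum_inter_fracPairs hintS
    obtain ⟨n2, hn2⟩ := exists_int_sum_inter_fracPairs hintQ
    obtain ⟨n3, hn3⟩ := exists_int_sum_inter_fracPairs (hsym hS)
    obtain ⟨n4, hn4⟩ := exists_int_sum_inter_fracPairs (hsym hQ)
    obtain ⟨n5, hn5⟩ : ∃ n : ℤ, ∑ e ∈ crossPairs {Q} S, y e = n := by
      refine ⟨#S - #Q, ?_⟩
      have := sum_sym2_eq_add_crossPairs y (K := {Q}) (S := S) (by simp) (by simpa using hQS)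
      rw [sum_singleton, hS.2, hQ.2] at this
      push_cast
      linarith
    obtain ⟨n6, hn6⟩ := exists_int_sum_inter_fracPairs ⟨n5, hn5⟩
    have h3 := hsplit y
    simp only [halfDegree_sdiff hQS, sub_mul, sum_sub_distrib, hy.sum_halfDegree, hn1, hn2, hn3,
      hn4, hn6] at h3
    refine ⟨2 * n3 + n1 - (2 * n4 + n2) - n6, ?_⟩
    push_cast
    linarith
  have hcount : ∃ n : ℤ, ∑ e ∈ fracPairs y, G e = n := by
    choose g hg using hGint
    exact ⟨∑ e ∈ fracPairs y, g e, by push_cast; exact sum_congr rfl fun e _ => hg e⟩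
  obtain ⟨q, hq⟩ := hmass
  obtain ⟨n, hn⟩ := hcount
  have hq0 : 0 < ∑ e ∈ fracPairs y, G e * y e :=
    sum_pos' (fun e _ => mul_nonneg (hG0 e) (hy.1 e))
      ⟨e₀, he₀, mul_pos hGe₀ (hy.pos_of_mem_fracPairs he₀)⟩
  have hqn : ∑ e ∈ fracPairs y, G e * y e < ∑ e ∈ fracPairs y, G e := by
    refine sum_lt_sum (fun e _ => mul_le_of_le_one_right (hG0 e) (hy.le_one e))
      ⟨e₀, he₀, mul_lt_of_lt_one_right hGe₀ (hy.lt_one_of_mem_fracPairs he₀)⟩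
  have hq1 : 1 ≤ ∑ e ∈ fracPairs y, G e * y e := by
    rw [hq] at hq0 ⊢
    have h4 : 0 < q := by exact_mod_cast hq0
    exact_mod_cast h4
  have hn2 : 2 ≤ ∑ e ∈ fracPairs y, G e := by
    have h4 := hq1.trans_lt hqn
    rw [hn] at h4 ⊢
    have h5 : 1 < n := by exact_mod_cast h4
    exact_mod_cast h5
  rw [nodeValue, singleton_biUnion, id, hsplit]
  simp only [mul_add, sum_sub_distrib, sum_add_distrib, sum_const, nsmul_eq_mul, ← sum_div,
    mul_div_assoc', mul_one] at h1 h2 ⊢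
  linarith

lemma ForestPoint.one_le_sum_halfDegree {y : Sym2 V → ℝ} (hy : ForestPoint y) {B S : Finset V}
    (hS : Tight y S) (hBS : B ⊆ S) (hB : B.Nonempty) (hne : B ≠ S)
    (hfrac : ∀ e ∈ cutPairs B ∩ S.sym2, y e ≠ 1) :
    1 ≤ ∑ e ∈ fracPairs y, halfDegree B e * (y e / 2 + 1 / 4) := by
  have h1 := hy.one_le_sum_cut hS hBS hB hne
  have h2 := sum_inter_fracPairs_eq y (cutPairs B ∩ S.sym2)
  rw [filter_eq_empty_iff.2 fun e he => hfrac e he, card_empty, Nat.cast_zero, add_zero] at h2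
  rw [h2] at h1
  have hsub : cutPairs B ∩ S.sym2 ∩ fracPairs y ⊆ cutPairs B ∩ fracPairs y :=
    inter_subset_inter inter_subset_left Subset.rfl
  have h3 : 1 ≤ ∑ e ∈ cutPairs B ∩ fracPairs y, y e :=
    h1.trans (sum_le_sum_of_subset_of_nonneg hsub fun e _ _ => hy.1 e)
  have hpos : (cutPairs B ∩ fracPairs y).Nonempty := by
    by_contra hcon
    rw [not_nonempty_iff_eq_empty.1 hcon, sum_empty] at h3
    linarith
  have h4 : ∑ e ∈ cutPairs B ∩ fracPairs y, y e < #(cutPairs B ∩ fracPairs y) := by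
    have := sum_lt_sum_of_nonempty (g := fun _ => (1 : ℝ)) hpos fun e he =>
      hy.lt_one_of_mem_fracPairs (mem_inter.1 he).2
    simpa using this
  have h5 : (2 : ℝ) ≤ #(cutPairs B ∩ fracPairs y) := by
    have h6 : (1 : ℝ) < #(cutPairs B ∩ fracPairs y) := h3.trans_lt h4
    have h7 : 1 < #(cutPairs B ∩ fracPairs y) := by exact_mod_cast h6
    exact_mod_cast h7
  have h6 : 0 ≤ ∑ e ∈ B.sym2 ∩ fracPairs y, (y e / 2 + 1 / 4) :=
    Finset.sum_nonneg fun e _ => by linarith [hy.1 e]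
  rw [hy.sum_halfDegree]
  rw [sum_add_distrib (s := cutPairs B ∩ fracPairs y), sum_const, ← sum_div, nsmul_eq_mul]
  linarith

lemma one_sub_card_le_nodeValue {y : Sym2 V → ℝ} {a : Sym2 V → Finset V} (hy : ForestPoint y)
    (ha : IsTightHull y a) {S : Finset V} (hS : Tight y S) {K : Finset (Finset V)}
    (hK : ∀ A ∈ K, Tight y A) (hKS : ∀ A ∈ K, A ⊆ S) (hKne : K.Nonempty) :
    1 - #K ≤ nodeValue y a K S := by
  obtain ⟨h1, h2⟩ := ha.sum_nonneg hy hS hK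
  let pairs := S.powerset.filter fun A => ∃ u v, A = {u, v} ∧ y s(u, v) = 1
  obtain ⟨P, hP1, hP2, hP3, hP4, hP5⟩ := hy.merge (K ∪ S.image singleton ∪ pairs) (by
    intro A hA
    simp only [mem_union, mem_image, pairs, mem_filter] at hA
    rcases hA with (hA | ⟨v, -, rfl⟩) | ⟨-, u, v, rfl, h⟩
    · exact hK A hA
    · exact hy.tight_singleton v
    · exact hy.tight_pair h)
  have hGS : ∀ A ∈ K ∪ S.image singleton ∪ pairs, A ⊆ S := by
    intro A hA
    simp only [mem_union, mem_image, pairs, mem_filter, mem_powerset] at hA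
    rcases hA with (hA | ⟨v, hv, rfl⟩) | ⟨h, -⟩
    · exact hKS A hA
    · exact singleton_subset_iff.2 hv
    · exact h
  have hPS : P.biUnion id = S := by
    ext v
    simp only [mem_biUnion, id]
    constructor
    · rintro ⟨B, hB, hv⟩
      obtain ⟨A, hA, hvA, -⟩ := hP4 B hB v hv
      exact hGS A hA hvA
    · intro hv
      obtain ⟨B, hB, hvB⟩ := hP3 {v} (by
        simp only [mem_union, mem_image]
        exact Or.inl (Or.inr ⟨v, hv, rfl⟩))
      exact ⟨B, hB, hvB (mem_singleton_self v)⟩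
  have hBS : ∀ B ∈ P, B ⊆ S := fun B hB => hPS ▸ subset_biUnion_of_mem id hB
  have heq : ∀ B ∈ P, ∀ B' ∈ P, ∀ v, v ∈ B → v ∈ B' → B = B' := fun B hB B' hB' v hv hv' =>
    by_contra fun hne => disjoint_left.1 (hP2 B hB B' hB' hne) hv hv'
  have hmassN : ∑ e ∈ crossPairs K S ∩ fracPairs y, y e ≤ #P - 1 := by
    have h3 := sum_crossPairs_of_tight hP2 hPS hP1
    rw [hS.2] at h3
    have hsub : crossPairs K S ∩ fracPairs y ⊆ crossPairs P S := by
      intro e he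
      obtain ⟨he1, he2⟩ := mem_inter.1 he
      rw [crossPairs, mem_filter] at he1 ⊢
      refine ⟨he1.1, fun B hB heB => ?_⟩
      obtain ⟨A, hA, heA⟩ := hP5 B hB e heB (mem_fracPairs.1 he2).1
      simp only [mem_union, mem_image, pairs, mem_filter] at hA
      have hed := hy.not_isDiag_of_mem_fracPairs he2
      rcases hA with (hA | ⟨v, -, rfl⟩) | ⟨-, u, v, rfl, h⟩
      · exact he1.2 A hA heA
      · rw [sym2_singleton, mem_singleton] at heA
        exact hed (heA ▸ Sym2.diag_isDiag v)
      · refine (mem_fracPairs.1 he2).2 ?_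
        rw [← h]
        congr 1
        induction e with | _ p q =>
        have h4 := mk_mem_sym2_iff.1 heA
        simp only [mem_insert, mem_singleton] at h4
        have h5 : p ≠ q := by simpa using hed
        rcases h4 with ⟨rfl | rfl, rfl | rfl⟩ <;> first | exact absurd rfl h5 | rfl | exact Sym2.eq_swap
    have h4 := sum_le_sum_of_subset_of_nonneg hsub fun e _ _ => hy.1 e
    linarith
  choose! g hgP hgsub using fun Q (hQ : Q ∈ K) => hP3 Q (mem_union_left _ (mem_union_left _ hQ))
  let P2 := P \ K.image g
  have hcardP2 : (#P : ℝ) - #K ≤ #P2 := by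
    have h3 : #P ≤ #P2 + #(K.image g) := by
      have := le_card_sdiff (K.image g) P
      simp only [P2]
      omega
    have h5 : #P ≤ #P2 + #K := h3.trans (Nat.add_le_add_left card_image_le _)
    have h4 : (#P : ℝ) ≤ #P2 + #K := by exact_mod_cast h5
    linarith
  have hwt : ∀ e, 0 ≤ y e / 2 + 1 / 4 := fun e => by linarith [hy.1 e]
  have hmain : (#P : ℝ) - #K ≤
      ∑ e ∈ fracPairs y, halfDegree (S \ K.biUnion id) e * (y e / 2 + 1 / 4) := by
    rcases le_or_gt #P 1 with hle | hlt
    · have h3 : (#P : ℝ) ≤ 1 := by exact_mod_cast hle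
      have h4 : (1 : ℝ) ≤ #K := by exact_mod_cast card_pos.2 hKne
      have h5 : 0 ≤ ∑ e ∈ fracPairs y, halfDegree (S \ K.biUnion id) e * (y e / 2 + 1 / 4) :=
        Finset.sum_nonneg fun e _ => mul_nonneg (halfDegree_nonneg _ _) (hwt e)
      linarith
    have hsub : P2.biUnion id ⊆ S \ K.biUnion id := by
      intro v hv
      obtain ⟨B, hB, hvB⟩ := mem_biUnion.1 hv
      obtain ⟨hBP, hBg⟩ := mem_sdiff.1 hB
      refine mem_sdiff.2 ⟨hBS B hBP hvB, fun hvK => ?_⟩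
      obtain ⟨Q, hQ, hvQ⟩ := mem_biUnion.1 hvK
      exact hBg (mem_image.2 ⟨Q, hQ, heq _ (hgP Q hQ) B hBP v (hgsub Q hQ hvQ) hvB⟩)
    calc (#P : ℝ) - #K ≤ ∑ B ∈ P2, (1 : ℝ) := by simpa using hcardP2
      _ ≤ ∑ B ∈ P2, ∑ e ∈ fracPairs y, halfDegree B e * (y e / 2 + 1 / 4) := by
        refine sum_le_sum fun B hB => ?_
        have hBP := (mem_sdiff.1 hB).1
        refine hy.one_le_sum_halfDegree hS (hBS B hBP) (hP1 B hBP).1 ?_ ?_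
        · rintro rfl
          obtain ⟨B', hB', hne⟩ := exists_mem_ne hlt B
          obtain ⟨v, hv⟩ := (hP1 B' hB').1
          exact hne (heq B' hB' B hBP v hv (hBS B' hB' hv))
        · intro e he h1
          rw [mem_inter] at he
          induction e with | _ u v =>
          obtain ⟨hu, hv⟩ := mk_mem_sym2_iff.1 he.2
          obtain ⟨B', hB', huv⟩ := hP3 {u, v} (mem_union_right _ (mem_filter.2
            ⟨mem_powerset.2 (insert_subset hu (singleton_subset_iff.2 hv)), u, v, rfl, h1⟩))
          have hu' : u ∈ B' := huv (by simp)
          have hv' : v ∈ B' := huv (by simp)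
          rcases mem_cutPairs_mk.1 he.1 with h | h
          · exact h.2 (heq B hBP B' hB' u h.1 hu' ▸ hv')
          · exact h.2 (heq B hBP B' hB' v h.1 hv' ▸ hu')
      _ = ∑ e ∈ fracPairs y, halfDegree (P2.biUnion id) e * (y e / 2 + 1 / 4) := by
        rw [sum_comm]
        refine sum_congr rfl fun e _ => ?_
        rw [halfDegree_biUnion fun A hA B hB => hP2 A (mem_sdiff.1 hA).1 B (mem_sdiff.1 hB).1,
          sum_mul]
      _ ≤ _ := sum_le_sum fun e _ =>
        mul_le_mul_of_nonneg_right (halfDegree_mono hsub e) (hwt e)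
  rw [nodeValue]
  simp only [sum_sub_distrib, sum_const, nsmul_eq_mul, mul_one] at h1 h2 ⊢
  linarith

lemma IsTightHull.sum_halfDegree_eq_sum_cutPairs {y d : Sym2 V → ℝ} {a : Sym2 V → Finset V}
    (hy : ForestPoint y) (ha : IsTightHull y a) (h1 : ∀ e ∉ fracPairs y, d e = 0)
    (h2 : ∀ A, ∑ f ∈ atom y a A, d f = 0) {S : Finset V} (hS : Tight y S) :
    ∑ e ∈ fracPairs y, halfDegree S e * d e = ∑ e ∈ cutPairs S, d e := by
  have h3 : ∀ s : Finset (Sym2 V), ∑ e ∈ s ∩ fracPairs y, d e = ∑ e ∈ s, d e := fun s =>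
    sum_subset inter_subset_left fun e he hne => h1 e fun h => hne (mem_inter.2 ⟨he, h⟩)
  rw [hy.sum_halfDegree, h3, h3, ha.sum_sym2_eq_zero h1 h2 hS, mul_zero, zero_add]

lemma IsTightHull.sum_cutPairs_eq {y d : Sym2 V → ℝ} {a : Sym2 V → Finset V}
    (hy : ForestPoint y) (ha : IsTightHull y a) (h1 : ∀ e ∉ fracPairs y, d e = 0)
    (h2 : ∀ A, ∑ f ∈ atom y a A, d f = 0) {S Q : Finset V} (hS : Tight y S) (hQ : Tight y Q)
    (hQS : Q ⊆ S)
    (heq : ∀ e ∈ fracPairs y, halfDegree (S \ Q) e = if e ∈ crossPairs {Q} S then 1 else 0) :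
    ∑ e ∈ cutPairs S, d e = ∑ e ∈ cutPairs Q, d e := by
  have h3 := sum_sym2_eq_add_crossPairs d (K := {Q}) (S := S) (by simp) (by simpa using hQS)
  rw [sum_singleton, ha.sum_sym2_eq_zero h1 h2 hS, ha.sum_sym2_eq_zero h1 h2 hQ, zero_add] at h3
  have h4 : ∑ e ∈ fracPairs y, halfDegree (S \ Q) e * d e = 0 := by
    rw [h3, sum_eq_sum_univ_ite (crossPairs {Q} S), sum_eq_sum_univ_ite (fracPairs y)]
    refine sum_congr rfl fun e _ => ?_
    by_cases he : e ∈ fracPairs y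
    · rw [if_pos he, heq e he]
      split_ifs <;> simp
    · rw [if_neg he, h1 e he, ite_self]
  rw [← ha.sum_halfDegree_eq_sum_cutPairs hy h1 h2 hS,
    ← ha.sum_halfDegree_eq_sum_cutPairs hy h1 h2 hQ, ← sub_eq_zero, ← sum_sub_distrib, ← h4]
  exact sum_congr rfl fun e _ => by rw [halfDegree_sdiff hQS]; ring

lemma Rigid.fracPairs_eq_empty {y : Sym2 V → ℝ} {a : Sym2 V → Finset V} {R : Finset (Finset V)}
    (hrig : Rigid y a R) (hy : ForestPoint y) (hV : Tight y univ) (ha : IsTightHull y a)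
    (hlam : ∀ A ∈ R, ∀ B ∈ R, Disjoint A B ∨ A ⊆ B ∨ B ⊆ A) (htight : ∀ S ∈ R, Tight y S)
    (hu : univ ∉ R) (hint : ∀ S ∈ R, ∃ n : ℤ, ∑ e ∈ cutPairs S, y e = n)
    (hcnt : ∀ S ∈ R, ∑ e ∈ cutPairs S, y e + 9 ≤ #((cutPairs S).filter fun e => y e ≠ 0)) :
    fracPairs y = ∅ := by
  obtain ⟨T, hTR, hT, hmin⟩ := hrig.exists_minimal
  have hcard : (#(fracPairs y) : ℝ) ≤ #((fracPairs y).image a) + #T := by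
    exact_mod_cast hT.card_le
  rcases T.eq_empty_or_nonempty with rfl | hTne
  · obtain ⟨h1, h2⟩ := ha.sum_nonneg hy hV (K := ∅) (by simp)
    rw [crossPairs_empty, sym2_univ, univ_inter] at h1 h2
    simp only [sum_sub_distrib, sum_atomWeight, sum_const, nsmul_eq_mul, mul_one] at h1 h2
    rw [card_empty, Nat.cast_zero, add_zero] at hcard
    have h3 : (#(fracPairs y) : ℝ) ≤ 0 := by linarith
    exact card_eq_zero.1 (by exact_mod_cast le_antisymm h3 (Nat.cast_nonneg _))
  have hlamT : ∀ A ∈ T, ∀ B ∈ T, Disjoint A B ∨ A ⊆ B ∨ B ⊆ A := fun A hA B hB =>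
    hlam A (hTR hA) B (hTR hB)
  have hneT : ∀ A ∈ T, A.Nonempty := fun A hA => (htight A (hTR hA)).1
  have huT : univ ∉ T := fun h => hu (hTR h)
  have hchild : ∀ S, ∀ Q ∈ children T S, Tight y Q := fun S Q hQ =>
    htight Q (hTR (mem_children.1 hQ).1)
  have hchildS : ∀ S, ∀ Q ∈ children T S, Q ⊆ S := fun S Q hQ => (mem_children.1 hQ).2.1.subset
  have hnode : ∀ S ∈ T, 3 - 2 * (#(children T S) : ℝ) ≤ nodeValue y a (children T S) S := by
    intro S hS
    have hSt := htight S (hTR hS)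
    rcases (children T S).eq_empty_or_nonempty with h0 | h0
    · rw [h0, card_empty]
      have := three_le_nodeValue hy ha hSt (hint S (hTR hS)) (hcnt S (hTR hS))
      simpa using this
    by_cases h1 : #(children T S) = 1
    · obtain ⟨Q, hQ⟩ := card_eq_one.1 h1
      have hQm : Q ∈ children T S := hQ ▸ mem_singleton_self Q
      obtain ⟨hQT, hQss, -⟩ := mem_children.1 hQm
      rw [h1, hQ]
      have := one_le_nodeValue hy ha hSt (hchild S Q hQm) (hchildS S Q hQm) (hint S (hTR hS))
        (hint Q (hTR hQT)) (by
          by_contra! hcon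
          obtain ⟨d, hd1, hd2, hd3, hd4⟩ := hmin S hS
          exact hd4 (by rw [ha.sum_cutPairs_eq hy hd1 hd2 hSt (hchild S Q hQm) hQss.subset hcon,
            hd3 Q hQT hQss.ne]))
      norm_num
      linarith
    · have h2 : 2 ≤ #(children T S) := by
        have := card_pos.2 h0
        omega
      have h3 : (2 : ℝ) ≤ #(children T S) := by exact_mod_cast h2
      have := one_sub_card_le_nodeValue hy ha hSt (hchild S) (hchildS S) h0
      linarith
  have hroot := one_sub_card_le_nodeValue hy ha hV (hchild univ) (hchildS univ)
    (children_univ_nonempty huT hTne)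
  have h1 := sum_nodeValue hy a hlamT hneT huT
  have h2 := sum_children hlamT hneT huT fun _ => 1
  rw [sum_insert huT] at h1 h2
  simp only [sum_const, nsmul_eq_mul, mul_one] at h2
  have h3 := sum_le_sum hnode
  rw [sum_sub_distrib, sum_const, ← mul_sum, nsmul_eq_mul] at h3
  have h4 : (0 : ℝ) ≤ #(children T univ) := Nat.cast_nonneg _
  exfalso
  linarith

lemma exists_minimizer_rigid {ι : Type*} [Fintype ι] {K : Set (ι → ℝ)} (hK : IsCompact K)
    (hne : K.Nonempty) (c : ι → ℝ) :
    ∃ y ∈ K, (∀ z ∈ K, ∑ e, c e * y e ≤ ∑ e, c e * z e) ∧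
      ∀ d : ι → ℝ, (∀ᶠ ε in nhdsWithin (0 : ℝ) (Set.Ioi 0), y + ε • d ∈ K) →
        (∀ᶠ ε in nhdsWithin (0 : ℝ) (Set.Ioi 0), y + ε • (-d) ∈ K) → d = 0 := by
  have hc : Continuous fun z : ι → ℝ => ∑ e, c e * z e := by fun_prop
  obtain ⟨m, hmK, hm⟩ := hK.exists_isMinOn hne hc.continuousOn
  have hface : IsCompact (K ∩ {z | ∑ e, c e * z e ≤ ∑ e, c e * m e}) :=
    hK.inter_right (isClosed_le hc continuous_const)
  obtain ⟨y, hy⟩ := hface.extremePoints_nonempty ⟨m, hmK, le_refl (∑ e, c e * m e)⟩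
  rw [mem_extremePoints] at hy
  have hmin : ∀ z ∈ K, ∑ e, c e * y e ≤ ∑ e, c e * z e := fun z hz =>
    le_trans hy.1.2 (hm hz)
  refine ⟨y, hy.1.1, hmin, fun d h1 h2 => ?_⟩
  obtain ⟨ε, ⟨hε1, hε2⟩, hε⟩ := ((h1.and h2).and self_mem_nhdsWithin).exists
  have hε : 0 < ε := hε
  have hsum : ∀ d : ι → ℝ, ∑ e, c e * (y + ε • d) e = ∑ e, c e * y e + ε * ∑ e, c e * d e := by
    intro d
    rw [mul_sum, ← sum_add_distrib]
    exact sum_congr rfl fun e _ => by simp; ring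
  have h3 := hmin _ hε1
  have h4 := hmin _ hε2
  have h5 : ∑ e, c e * (-d) e = -∑ e, c e * d e := by simp
  rw [hsum] at h3 h4
  rw [h5] at h4
  have h6 : ε * ∑ e, c e * d e = 0 := by linarith
  have h7 := hy.2 (y + ε • d) ⟨hε1, by rw [Set.mem_ofPred, hsum, h6, add_zero]; exact hy.1.2⟩
    (y + ε • (-d)) ⟨hε2, by
      rw [Set.mem_ofPred, hsum, h5, mul_neg, h6, neg_zero, add_zero]; exact hy.1.2⟩
    ⟨1 / 2, 1 / 2, by norm_num, by norm_num, by norm_num, by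
      ext e; simp; ring⟩
  have h8 : ε • d = 0 := by simpa using h7
  exact (smul_eq_zero.1 h8).resolve_left hε.ne'

/-- The forest points supported in the support of `z` that are tight on `V` and on every member
of `L`, with at most `b P` units of mass on the cut of every `P ∈ R`. -/
def boundedForests (z : Sym2 V → ℝ) (L R : Finset (Finset V)) (b : Finset V → ℤ) :
    Set (Sym2 V → ℝ) :=
  {y | ForestPoint y ∧ Tight y univ ∧ (∀ P ∈ L, Tight y P) ∧ (∀ e, z e = 0 → y e = 0) ∧
    ∀ P ∈ R, ∑ e ∈ cutPairs P, y e ≤ b P}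

lemma isCompact_boundedForests (z : Sym2 V → ℝ) (L R : Finset (Finset V)) (b : Finset V → ℤ) :
    IsCompact (boundedForests z L R b) := by
  have hsum : ∀ s : Finset (Sym2 V), Continuous fun y : Sym2 V → ℝ => ∑ e ∈ s, y e := fun s => by
    fun_prop
  have hT : ∀ P : Finset V, IsClosed {y : Sym2 V → ℝ | Tight y P} := fun P =>
    isClosed_const.and (isClosed_eq (hsum _) continuous_const)
  have hcl : IsClosed (boundedForests z L R b) := by
    refine isClosed_forestPoint.and ((hT univ).and (IsClosed.and ?_ (IsClosed.and ?_ ?_)))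
    · simp only [Set.ofPred_forall]
      exact isClosed_iInter fun P => isClosed_iInter fun _ => hT P
    · simp only [Set.ofPred_forall]
      exact isClosed_iInter fun e => isClosed_iInter fun _ =>
        isClosed_eq (continuous_apply e) continuous_const
    · simp only [Set.ofPred_forall]
      exact isClosed_iInter fun P => isClosed_iInter fun _ =>
        isClosed_le (hsum _) continuous_const
  refine (isCompact_Icc (a := (0 : Sym2 V → ℝ)) (b := 1)).of_isClosed_subset hcl fun y hy => ?_
  exact ⟨fun e => hy.1.1 e, fun e => hy.1.le_one e⟩

lemma eventually_mem_boundedForests {z y d : Sym2 V → ℝ} {L R : Finset (Finset V)}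
    {b : Finset V → ℤ} {a : Sym2 V → Finset V} (hy : y ∈ boundedForests z L R b)
    (ha : IsTightHull y a) (h1 : ∀ e ∉ fracPairs y, d e = 0)
    (h2 : ∀ A, ∑ f ∈ atom y a A, d f = 0)
    (h3 : ∀ P ∈ R, ∑ e ∈ cutPairs P, y e = b P → ∑ e ∈ cutPairs P, d e = 0) :
    ∀ᶠ ε in nhdsWithin (0 : ℝ) (Set.Ioi 0), y + ε • d ∈ boundedForests z L R b := by
  obtain ⟨hF, hV, hL, hz, hR⟩ := hy
  have h0 : ∀ e, y e = 0 → d e = 0 := fun e he => h1 e fun h => (mem_fracPairs.1 h).1 he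
  have hS : ∀ S, Tight y S → ∑ e ∈ S.sym2, d e = 0 := fun S hS => ha.sum_sym2_eq_zero h1 h2 hS
  have hsum : ∀ (ε : ℝ) (s : Finset (Sym2 V)),
      ∑ e ∈ s, (y + ε • d) e = ∑ e ∈ s, y e + ε * ∑ e ∈ s, d e := fun ε s => by
    simp [sum_add_distrib, mul_sum]
  have hT : ∀ (ε : ℝ) S, Tight y S → Tight (y + ε • d) S := fun ε S h =>
    ⟨h.1, by rw [hsum, hS S h, mul_zero, add_zero, h.2]⟩
  have hcut : ∀ᶠ ε in nhdsWithin (0 : ℝ) (Set.Ioi 0),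
      ∀ P ∈ R, ∑ e ∈ cutPairs P, y e + ε * ∑ e ∈ cutPairs P, d e ≤ b P + ε * 0 :=
    (Filter.eventually_all_finset R).2 fun P hP =>
      eventually_add_mul_le (hR P hP) fun h => (h3 P hP h).le
  filter_upwards [hF.eventually_add_smul (fun e he => (h0 e he).ge) fun U hU => (hS U hU).le, hcut]
    with ε hε1 hε2
  refine ⟨hε1, hT ε _ hV, fun P hP => hT ε P (hL P hP), fun e he => ?_, fun P hP => ?_⟩
  · simp [hz e he, h0 e (hz e he)]
  · rw [hsum]
    simpa using hε2 P hP

lemma exists_isTree_of_boundedForests [Nonempty V] {L : Finset (Finset V)}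
    (hlam : ∀ A ∈ L, ∀ B ∈ L, Disjoint A B ∨ A ⊆ B ∨ B ⊆ A) (hu : univ ∉ L) (b : Finset V → ℤ)
    (c : Sym2 V → ℝ) (R : Finset (Finset V)) (hR : R ⊆ L) (z : Sym2 V → ℝ)
    (hz : z ∈ boundedForests z L R b) :
    ∃ T : SimpleGraph V, T.IsTree ∧ (∀ e ∈ T.edgeSet, z e ≠ 0) ∧
      ∑ e ∈ T.edgeFinset, c e ≤ ∑ e, c e * z e ∧
      ∀ P ∈ R, (#(T.edgeFinset ∩ cutPairs P) : ℝ) ≤ b P + 8 := by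
  induction R using Finset.strongInduction generalizing z with
  | H R ih =>
  obtain ⟨y, hyK, hcost, hrig⟩ := exists_minimizer_rigid (isCompact_boundedForests z L R b)
    ⟨z, hz⟩ c
  have hcz := hcost z hz
  obtain ⟨hy, hV, hL, hzy, hyR⟩ := id hyK
  by_cases hex : ∃ P ∈ R, #((cutPairs P).filter fun e => y e ≠ 0) ≤ b P + 8
  · obtain ⟨P, hP, hcard⟩ := hex
    obtain ⟨T, hT, hTy, hTc, hTR⟩ := ih (R.erase P) (erase_ssubset hP)
      ((erase_subset P R).trans hR) y
      ⟨hy, hV, hL, fun _ h => h, fun Q hQ => hyR Q (mem_of_mem_erase hQ)⟩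
    refine ⟨T, hT, fun e he h => hTy e he (hzy e h), hTc.trans hcz, fun Q hQ => ?_⟩
    by_cases hQP : Q = P
    · subst hQP
      have h1 : #(T.edgeFinset ∩ cutPairs Q) ≤ #((cutPairs Q).filter fun e => y e ≠ 0) :=
        card_le_card fun e he => by
          rw [mem_inter, SimpleGraph.mem_edgeFinset] at he
          exact mem_filter.2 ⟨he.2, hTy e he.1⟩
      have h2 : (#(T.edgeFinset ∩ cutPairs Q) : ℤ) ≤ b Q + 8 := le_trans (by exact_mod_cast h1) hcard
      exact_mod_cast h2
    · exact hTR Q (mem_erase.2 ⟨hQP, hQ⟩)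
  push Not at hex
  obtain ⟨a, ha⟩ := hy.exists_isTightHull hV
  have hrigid : Rigid y a (R.filter fun P => ∑ e ∈ cutPairs P, y e = b P) := by
    intro d h1 h2 h3
    have h3 : ∀ P ∈ R, ∑ e ∈ cutPairs P, y e = b P → ∑ e ∈ cutPairs P, d e = 0 :=
      fun P hP h => h3 P (mem_filter.2 ⟨hP, h⟩)
    refine hrig d (eventually_mem_boundedForests hyK ha h1 h2 h3)
      (eventually_mem_boundedForests hyK ha (fun e he => ?_) (fun A => ?_) fun P hP h => ?_)
    · simp [h1 e he]
    · simp [h2 A]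
    · simp [h3 P hP h]
  have hempty := hrigid.fracPairs_eq_empty hy hV ha
    (fun A hA B hB => hlam A (hR (mem_filter.1 hA).1) B (hR (mem_filter.1 hB).1))
    (fun S hS => hL S (hR (mem_filter.1 hS).1)) (fun h => hu (hR (mem_filter.1 h).1))
    (fun S hS => ⟨b S, (mem_filter.1 hS).2⟩) fun S hS => by
      rw [(mem_filter.1 hS).2]
      have := hex S (mem_filter.1 hS).1
      exact_mod_cast (show b S + 9 ≤ #((cutPairs S).filter fun e => y e ≠ 0) by omega)
  have hint : ∀ e, y e = 0 ∨ y e = 1 := fun e => by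
    by_contra! h
    have h1 := mem_fracPairs.2 h
    simp [hempty] at h1
  obtain ⟨T, hT, hTy⟩ := hy.exists_isTree_of_integral hV hint
  have hyT : ∀ e, e ∈ T.edgeFinset ↔ y e ≠ 0 := fun e => by
    rw [SimpleGraph.mem_edgeFinset, hTy]
  have hy1 : ∀ e ∈ T.edgeFinset, y e = 1 := fun e he => (hint e).resolve_left ((hyT e).1 he)
  refine ⟨T, hT, fun e he h => (hTy e).1 he (hzy e h), ?_, fun P hP => ?_⟩
  · refine le_trans (le_of_eq ?_) hcz
    rw [← sum_subset (subset_univ T.edgeFinset) fun e _ he => by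
      rw [not_not.1 (mt (hyT e).2 he), mul_zero]]
    exact sum_congr rfl fun e he => by rw [hy1 e he, mul_one]
  · have h1 := hyR P hP
    have h2 : (#(T.edgeFinset ∩ cutPairs P) : ℝ) = ∑ e ∈ T.edgeFinset ∩ cutPairs P, y e := by
      rw [sum_congr rfl fun e he => hy1 e (mem_inter.1 he).1, sum_const, nsmul_eq_mul, mul_one]
    have h3 := sum_le_sum_of_subset_of_nonneg
      (inter_subset_right (s₁ := T.edgeFinset) (s₂ := cutPairs P)) fun e _ _ => hy.1 e
    linarith

lemma ForestPoint.sum_halfDegree_univ {y : Sym2 V → ℝ} (hy : ForestPoint y) (X : Finset V) :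
    ∑ e, halfDegree X e * y e = 2 * ∑ e ∈ X.sym2, y e + ∑ e ∈ cutPairs X, y e := by
  rw [sum_eq_sum_univ_ite X.sym2, sum_eq_sum_univ_ite (cutPairs X), mul_sum, ← sum_add_distrib]
  refine sum_congr rfl fun e _ => ?_
  by_cases he : e.IsDiag
  · simp [hy.eq_zero_of_isDiag he]
  · rw [halfDegree_eq X he]
    split_ifs <;> ring

lemma ForestPoint.sum_sum_cutPairs {y : Sym2 V → ℝ} (hy : ForestPoint y) {K : Finset (Finset V)}
    {S : Finset V} (hK : ∀ A ∈ K, ∀ B ∈ K, A ≠ B → Disjoint A B) (hS : K.biUnion id = S) :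
    ∑ P ∈ K, ∑ e ∈ cutPairs P, y e =
      ∑ e ∈ cutPairs S, y e + 2 * ∑ e ∈ crossPairs K S, y e := by
  have h1 := sum_sym2_eq_add_crossPairs y hK fun A hA => hS ▸ subset_biUnion_of_mem id hA
  have h2 : ∑ e, halfDegree S e * y e = ∑ P ∈ K, ∑ e, halfDegree P e * y e := by
    rw [sum_comm, ← hS]
    exact sum_congr rfl fun e _ => by rw [halfDegree_biUnion hK, sum_mul]
  simp only [hy.sum_halfDegree_univ, sum_add_distrib, ← mul_sum] at h2
  linarith

/-- The number of parts of a partition of `S` into sets tight for `z` is controlled by the cut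
of `S`, when `z = η x` across the parts. -/
lemma sub_one_mul_card_le {x z : Sym2 V → ℝ} {η : ℝ} (hx : ForestPoint x) (hxV : Tight x univ)
    (hz : ForestPoint z) (hη : 0 ≤ η) {K : Finset (Finset V)} {S : Finset V}
    (hK : ∀ A ∈ K, ∀ B ∈ K, A ≠ B → Disjoint A B) (hS : K.biUnion id = S)
    (hKt : ∀ A ∈ K, Tight z A) (hne : S.Nonempty) (huniv : S ≠ univ)
    (hcross : ∀ e ∈ crossPairs K S, z e = η * x e) :
    ∑ e ∈ crossPairs K S, z e ≤ #K - 1 ∧ (η - 1) * #K ≤ η * ∑ e ∈ cutPairs S, x e - 1 := by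
  have h1 := sum_crossPairs_of_tight hK hS hKt
  have h2 := hz.2 S hne
  have h3 : ∑ e ∈ crossPairs K S, z e = η * ∑ e ∈ crossPairs K S, x e := by
    rw [mul_sum]
    exact sum_congr rfl hcross
  have h4 := sum_sym2_eq_add_crossPairs x hK fun A hA => hS ▸ subset_biUnion_of_mem id hA
  have h5 : ∑ A ∈ K, ∑ e ∈ A.sym2, x e ≤ #S - #K := by
    calc ∑ A ∈ K, ∑ e ∈ A.sym2, x e ≤ ∑ A ∈ K, ((#A : ℝ) - 1) :=
          sum_le_sum fun A hA => hx.2 A (hKt A hA).1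
      _ = #S - #K := by
          have hc : (#S : ℝ) = ∑ A ∈ K, (#A : ℝ) := by
            rw [← hS]
            exact_mod_cast card_biUnion (t := id) fun A hA B hB hAB => hK A hA B hB hAB
          rw [hc]
          simp
  have h6 := sum_sym2_eq_add_cut x (subset_univ S)
  have h7 : (univ \ S).Nonempty := by
    rw [nonempty_iff_ne_empty, Ne, sdiff_eq_empty_iff_subset]
    exact fun h => huniv (univ_subset_iff.1 h)
  have h8 := hx.2 _ h7
  have h9 : (#(univ \ S) : ℝ) = #(univ : Finset V) - #S := by
    rw [card_sdiff_of_subset (subset_univ S), Nat.cast_sub (card_le_card (subset_univ S))]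
  rw [hxV.2, sym2_univ, inter_univ] at h6
  have h10 : (#K : ℝ) ≤ ∑ e ∈ crossPairs K S, x e + ∑ e ∈ cutPairs S, x e := by linarith
  have h11 := mul_le_mul_of_nonneg_left h10 hη
  constructor <;> nlinarith

lemma sum_cutPairs_add_nine_le {x z : Sym2 V → ℝ} (hx : ForestPoint x) (hxV : Tight x univ)
    (hz : ForestPoint z) (hzx : ∀ e, z e ≤ (2 + Real.sqrt 7) * x e) {K : Finset (Finset V)}
    {S : Finset V} (hK : ∀ A ∈ K, ∀ B ∈ K, A ≠ B → Disjoint A B) (hS : K.biUnion id = S)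
    (hKt : ∀ A ∈ K, Tight z A) (hne : S.Nonempty) (huniv : S ≠ univ)
    (hcross : ∀ e ∈ crossPairs K S, z e = (2 + Real.sqrt 7) * x e) :
    ∑ P ∈ K, (∑ e ∈ cutPairs P, z e + 9) ≤
      (2 + Real.sqrt 7) ^ 2 * ∑ e ∈ cutPairs S, x e := by
  have h7 : Real.sqrt 7 ^ 2 = 7 := Real.sq_sqrt (by norm_num)
  have h2 : 2 ≤ Real.sqrt 7 := Real.le_sqrt_of_sq_le (by norm_num)
  obtain ⟨h3, h4⟩ := sub_one_mul_card_le hx hxV hz (by positivity) hK hS hKt hne huniv hcross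
  have h5 : ∑ e ∈ cutPairs S, z e ≤ (2 + Real.sqrt 7) * ∑ e ∈ cutPairs S, x e := by
    rw [mul_sum]
    exact sum_le_sum fun e _ => hzx e
  rw [sum_add_distrib, hz.sum_sum_cutPairs hK hS, sum_const, nsmul_eq_mul]
  have h6 : (11 : ℝ) * #K ≤ (1 + Real.sqrt 7) ^ 2 * #K :=
    mul_le_mul_of_nonneg_right (by nlinarith) (Nat.cast_nonneg _)
  have h8 := mul_le_mul_of_nonneg_left h4 (show (0 : ℝ) ≤ 1 + Real.sqrt 7 by positivity)
  nlinarith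

lemma card_inter_cutPairs_le (F : Finset (Sym2 V)) {K : Finset (Finset V)} {S : Finset V}
    (hS : K.biUnion id = S) : #(F ∩ cutPairs S) ≤ ∑ P ∈ K, #(F ∩ cutPairs P) := by
  have key : ∀ u v, u ∈ S → v ∉ S → ∃ P ∈ K, u ∈ P ∧ v ∉ P := fun u v hu hv => by
    rw [← hS] at hu hv
    obtain ⟨P, hP, huP⟩ := mem_biUnion.1 hu
    exact ⟨P, hP, huP, fun h => hv (mem_biUnion.2 ⟨P, hP, h⟩)⟩
  refine le_trans (card_le_card fun e he => ?_) card_biUnion_le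
  rw [mem_inter] at he
  rw [mem_biUnion]
  induction e with | _ u v =>
  rcases mem_cutPairs_mk.1 he.2 with h | h
  · obtain ⟨P, hP, h1⟩ := key u v h.1 h.2
    exact ⟨P, hP, mem_inter.2 ⟨he.1, mem_cutPairs_mk.2 (Or.inl h1)⟩⟩
  · obtain ⟨P, hP, h1⟩ := key v u h.1 h.2
    exact ⟨P, hP, mem_inter.2 ⟨he.1, mem_cutPairs_mk.2 (Or.inr h1)⟩⟩

lemma exists_isTree_of_forestPoint [Nonempty V] {x : Sym2 V → ℝ} (hx : ForestPoint x)
    (hxV : Tight x univ) {c : Sym2 V → ℝ} (hc : ∀ e, 0 ≤ c e) {L : Finset (Finset V)}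
    (hL : ∀ S ∈ L, ∀ T ∈ L, Disjoint S T ∨ S ⊆ T ∨ T ⊆ S) :
    ∃ T : SimpleGraph V, T.IsTree ∧ (∀ e ∈ T.edgeSet, x e ≠ 0) ∧
      ∑ e ∈ T.edgeFinset, c e ≤ (2 + Real.sqrt 7) * ∑ e, c e * x e ∧
      ∀ S ∈ L, S.Nonempty → S ≠ univ → (#(T.edgeFinset ∩ cutPairs S) : ℝ) ≤
        (2 + Real.sqrt 7) ^ 2 * ∑ e ∈ cutPairs S, x e := by
  have hη : 1 ≤ 2 + Real.sqrt 7 := by linarith [Real.sqrt_nonneg 7]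
  obtain ⟨z, hz, hzx, hzV, hal⟩ := exists_aligned hx hxV hη (L := insert univ L) (by
    intro S hS T hT
    rcases mem_insert.1 hS with rfl | hS
    · exact Or.inr (Or.inr (subset_univ T))
    rcases mem_insert.1 hT with rfl | hT
    · exact Or.inr (Or.inl (subset_univ S))
    exact hL S hS T hT) (mem_insert_self _ _)
  choose K hKt hKd hKS hKmax using hz.exists_tight_partition
  have hKsub : ∀ S, ∀ A ∈ K S, A ⊆ S := fun S A hA => hKS S ▸ subset_biUnion_of_mem id hA
  let M := (L.erase univ).biUnion K
  have hnest : ∀ S T A B, S ⊆ T → A ∈ K S → B ∈ K T → Disjoint A B ∨ A ⊆ B := by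
    intro S T A B hST hA hB
    obtain ⟨B', hB', hAB'⟩ := hKmax T A (hKt S A hA) ((hKsub S A hA).trans hST)
    by_cases h : B' = B
    · exact Or.inr (h ▸ hAB')
    · exact Or.inl (disjoint_of_subset_left hAB' (hKd T B' hB' B hB h))
  obtain ⟨T, hT, hTz, hTc, hTM⟩ := exists_isTree_of_boundedForests (L := M) (by
      intro A hA B hB
      obtain ⟨S, hS, hAS⟩ := mem_biUnion.1 hA
      obtain ⟨S', hS', hBS⟩ := mem_biUnion.1 hB
      rcases hL S (mem_of_mem_erase hS) S' (mem_of_mem_erase hS') with h | h | h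
      · exact Or.inl (disjoint_of_subset_left (hKsub S A hAS)
          (disjoint_of_subset_right (hKsub S' B hBS) h))
      · exact (hnest S S' A B h hAS hBS).imp_right Or.inl
      · exact (hnest S' S B A h hBS hAS).imp (fun h => h.symm) Or.inr) (by
      intro h
      obtain ⟨S, hS, hAS⟩ := mem_biUnion.1 h
      exact (mem_erase.1 hS).1 (univ_subset_iff.1 (hKsub S univ hAS)))
    (fun P => ⌈∑ e ∈ cutPairs P, z e⌉) c M Subset.rfl z
    ⟨hz, hzV, fun P hP => by
      obtain ⟨S, -, hPS⟩ := mem_biUnion.1 hP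
      exact hKt S P hPS, fun _ h => h, fun P _ => Int.le_ceil _⟩
  refine ⟨T, hT, fun e he h => hTz e he ?_, hTc.trans ?_, fun S hS hne huniv => ?_⟩
  · exact le_antisymm (by simpa [h] using hzx e) (hz.1 e)
  · rw [mul_sum]
    exact sum_le_sum fun e _ => by
      rw [mul_left_comm]
      exact mul_le_mul_of_nonneg_left (hzx e) (hc e)
  · calc (#(T.edgeFinset ∩ cutPairs S) : ℝ)
        ≤ ∑ P ∈ K S, (#(T.edgeFinset ∩ cutPairs P) : ℝ) := by
          exact_mod_cast card_inter_cutPairs_le T.edgeFinset (hKS S)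
      _ ≤ ∑ P ∈ K S, (∑ e ∈ cutPairs P, z e + 9) := by
          refine sum_le_sum fun P hP => ?_
          have h1 := hTM P (mem_biUnion.2 ⟨S, mem_erase.2 ⟨huniv, hS⟩, hP⟩)
          have h2 := Int.ceil_lt_add_one (∑ e ∈ cutPairs P, z e)
          linarith
      _ ≤ _ := by
          refine sum_cutPairs_add_nine_le hx hxV hz hzx (hKd S) (hKS S) (hKt S) hne huniv
            fun e he => ?_
          rw [crossPairs, mem_filter] at he
          by_contra hne
          obtain ⟨U, hU, heU, hUS⟩ := hal S (mem_insert_of_mem hS) e he.1 hne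
          obtain ⟨B, hB, hUB⟩ := hKmax S U hU hUS
          exact he.2 B hB (sym2_mono hUB heU)

lemma cutEdges_eq (G : SimpleGraph V) (S : Finset V) :
    cutEdges G S = G.edgeFinset ∩ cutPairs S := by
  ext e
  simp only [cutEdges, mem_filter, mem_inter, SimpleGraph.mem_edgeFinset]
  induction e with | _ u v =>
  rw [mem_cutPairs_mk]
  simp only [mem_univ, true_and, mem_coe]
  refine and_congr_right fun _ => ⟨?_, ?_⟩
  · rintro ⟨p, q, h, hp, hq⟩
    rcases Sym2.eq_iff.1 h with ⟨rfl, rfl⟩ | ⟨rfl, rfl⟩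
    · exact Or.inl ⟨hp, hq⟩
    · exact Or.inr ⟨hp, hq⟩
  · rintro (h | h)
    · exact ⟨u, v, rfl, h⟩
    · exact ⟨v, u, Sym2.eq_swap, h⟩

end

/-- Thin trees for laminar families (main theorem, `η = 2 + √7`). -/
theorem laminar_thin_tree [Fintype V] (G : SimpleGraph V) (hG : G.Connected)
    (L : Set (Set V)) (hL : Laminar L)
    (c : Sym2 V → ℝ) (hc : ∀ e, 0 ≤ c e)
    (x : Sym2 V → ℝ) (hx : x ∈ stPolytope G) :
    ∃ T : SimpleGraph V, T ≤ G ∧ T.IsTree ∧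
      (∑ e ∈ T.edgeFinset, c e) ≤ (2 + Real.sqrt 7) * ∑ e ∈ G.edgeFinset, c e * x e ∧
      ∀ S ∈ L, ((T.edgeFinset ∩ cutEdges G S).card : ℝ) ≤
        (2 + Real.sqrt 7) ^ 2 * ∑ e ∈ cutEdges G S, x e := by
  have : Nonempty V := hG.nonempty
  obtain ⟨hxF, hxs, hxG⟩ := forestPoint_of_mem_stPolytope hx
  have hx0 : ∀ e ∉ G.edgeFinset, x e = 0 := fun e he =>
    not_not.1 fun h => he (SimpleGraph.mem_edgeFinset.2 (hxG e h))
  obtain ⟨T, hT, hTx, hTc, hTL⟩ := exists_isTree_of_forestPoint hxF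
    ⟨univ_nonempty, by rw [sym2_univ, hxs, card_univ]⟩ hc
    (L := univ.filter fun S : Finset V => (S : Set V) ∈ L) fun S hS S' hS' => by
      rcases hL S S' (mem_filter.1 hS).2 (mem_filter.1 hS').2 with h | h | h
      · rw [← Set.disjoint_iff_inter_eq_empty, disjoint_coe] at h
        exact Or.inl h
      · rw [Set.inter_eq_left, coe_subset] at h
        exact Or.inr (Or.inl h)
      · rw [Set.inter_eq_right, coe_subset] at h
        exact Or.inr (Or.inr h)
  have hTG : T ≤ G := SimpleGraph.edgeSet_subset_edgeSet.1 fun e he => hxG e (hTx e he)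
  refine ⟨T, hTG, hT, hTc.trans_eq ?_, fun S hS => ?_⟩
  · congr 1
    exact (sum_subset (subset_univ G.edgeFinset) fun e _ he => by rw [hx0 e he, mul_zero]).symm
  lift S to Finset V using S.toFinite
  have hsum : ∑ e ∈ cutEdges G S, x e = ∑ e ∈ cutPairs S, x e := by
    rw [cutEdges_eq]
    exact sum_subset inter_subset_right fun e he hne =>
      hx0 e fun h => hne (mem_inter.2 ⟨h, he⟩)
  by_cases hcut : S.Nonempty ∧ S ≠ univ
  · rw [hsum]
    refine le_trans ?_ (hTL S (mem_filter.2 ⟨mem_univ S, hS⟩) hcut.1 hcut.2)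
    rw [cutEdges_eq]
    exact_mod_cast card_le_card (inter_subset_inter Subset.rfl inter_subset_right)
  · have hempty : cutEdges G S = ∅ := by
      refine eq_empty_of_forall_notMem fun e he => ?_
      simp only [cutEdges, mem_filter] at he
      obtain ⟨-, -, u, v, -, hu, hv⟩ := he
      exact hcut ⟨⟨u, hu⟩, fun h => hv (by simp [h])⟩
    simp [hempty]
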